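/- Let G be a connected compact metric graph with exponents p̄ = (p_e), 1 < p_e < ∞, and nonlinearities γ_e : ℝ → ℝ continuous, strictly increasing and surjective with γ_e(0) = 0. For i = 1, 2, let f^i = (f^i_e) with f^i_e ∈ L^{p_e'}((0,T)×(0,ℓ_e)) for every T > 0 and every edge e, let ω_i : (0,∞) → ℝ^V be measurable and essentially bounded on (0,T) for every T > 0, let v_{i,0} = (v_{i,0,e}) with v_{i,0,e} ∈ L^1(0,ℓ_e) and Σ_{e∈E} ∫₀^{ℓ_e} j*_{γ_e}(v_{i,0,e}) < ∞, and let v_i be a weak solution of the evolution problem with data (f^i, ω_i, v_{i,0}). Then for every t > 0: Σ_{e∈E} ∫₀^{ℓ_e} (v_{1,e}(t) − v_{2,e}(t))⁺ ≤ Σ_{e∈E} ∫₀^{ℓ_e} (v_{1,0,e} − v_{2,0,e})⁺ + ∫₀^t Σ_{e∈E} ∫₀^{ℓ_e} (f^1_e(s) − f^2_e(s))⁺ dx ds + Σ_{v∈V} ∫₀^t (ω_1(s)(v) − ω_2(s)(v))⁺ ds. -/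

import Mathlib

open MeasureTheory Set Filter

noncomputable section

/-- A connected compact metric graph: finite nonempty vertex set, finite edge set,
initial/terminal vertex maps without loops, positive edge lengths, no multiple edges,
and connectedness via paths of edges. -/
structure MetricGraph where
  V : Type
  E : Type
  fintypeV : Fintype V
  fintypeE : Fintype E
  nonemptyV : Nonempty V
  ι : E → V
  τ : E → V
  no_loops : ∀ e, ι e ≠ τ e
  len : E → ℝ
  len_pos : ∀ e, 0 < len e
  no_multi : ∀ e e', ({ι e, τ e} : Set V) = ({ι e', τ e'} : Set V) → e = e'
  connected : ∀ v w : V,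
    Relation.ReflTransGen (fun a b => ∃ e, (ι e = a ∧ τ e = b) ∨ (ι e = b ∧ τ e = a)) v w

/-- Sum over the edges of the graph. -/
def edgeSum (G : MetricGraph) (F : G.E → ℝ) : ℝ :=
  letI := G.fintypeE
  ∑ e, F e

/-- Sum over the vertices of the graph. -/
def vertexSum (G : MetricGraph) (F : G.V → ℝ) : ℝ :=
  letI := G.fintypeV
  ∑ v, F v

/-- Number of vertices. -/
def vertexCard (G : MetricGraph) : ℕ :=
  letI := G.fintypeV
  Fintype.card G.V

/-- ρ_p(r) = |r|^(p-2) r. -/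
def rho (p r : ℝ) : ℝ := |r| ^ (p - 2) * r

/-- `(u, u')` is in the Sobolev space W^{1,p}(0,ℓ): `u'` is integrable with `|u'|^p`
integrable on (0,ℓ), and `u` is absolutely continuous on [0,ℓ] with derivative `u'`. -/
def IntervalSobolev (ℓ p : ℝ) (u u' : ℝ → ℝ) : Prop :=
  IntegrableOn u' (Ioo 0 ℓ) volume ∧
  IntegrableOn (fun x => |u' x| ^ p) (Ioo 0 ℓ) volume ∧
  ∀ x ∈ Icc (0:ℝ) ℓ, u x = u 0 + ∫ t in (0:ℝ)..x, u' t

/-- `(u, u')` is in W^{1,p̄}(G), continuous at the vertices with vertex values `uV`. -/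
def GraphSobolev (G : MetricGraph) (p : G.E → ℝ) (u u' : G.E → ℝ → ℝ) (uV : G.V → ℝ) : Prop :=
  (∀ e, IntervalSobolev (G.len e) (p e) (u e) (u' e)) ∧
  (∀ e, u e 0 = uV (G.ι e)) ∧
  (∀ e, u e (G.len e) = uV (G.τ e))

/-- `v` is a weak solution of the graph problem (P_ω^f) with data `u, u', uV`. -/
def SolvesGraphProblem (G : MetricGraph) (p : G.E → ℝ) (γ : G.E → ℝ → ℝ)
    (f : G.E → ℝ → ℝ) (ω : G.V → ℝ)
    (v : G.E → ℝ → ℝ) (u u' : G.E → ℝ → ℝ) (uV : G.V → ℝ) : Prop :=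
  (∀ e, IntegrableOn (v e) (Ioo 0 (G.len e)) volume) ∧
  GraphSobolev G p u u' uV ∧
  (∀ e, ∀ᵐ x ∂(volume.restrict (Ioo 0 (G.len e))), v e x = γ e (u e x)) ∧
  ∀ φ φ' : G.E → ℝ → ℝ, ∀ φV : G.V → ℝ, GraphSobolev G p φ φ' φV →
    edgeSum G (fun e => ∫ x in Ioo 0 (G.len e), v e x * φ e x)
      + edgeSum G (fun e => ∫ x in Ioo 0 (G.len e), rho (p e) (u' e x) * φ' e x)
    = edgeSum G (fun e => ∫ x in Ioo 0 (G.len e), f e x * φ e x)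
      + vertexSum G (fun w => ω w * φV w)

/-- `v` is a weak solution of the graph problem (P_ω^f). -/
def IsGraphWeakSolution (G : MetricGraph) (p : G.E → ℝ) (γ : G.E → ℝ → ℝ)
    (f : G.E → ℝ → ℝ) (ω : G.V → ℝ) (v : G.E → ℝ → ℝ) : Prop :=
  ∃ u u' uV, SolvesGraphProblem G p γ f ω v u u' uV

/-- `v` is a weak solution of the interval Neumann problem (P^{γ,f}_{p,a,b}),
with associated Sobolev function `u` (derivative `u'`). -/
def SolvesNeumann (ℓ p : ℝ) (γ f : ℝ → ℝ) (a b : ℝ) (v u u' : ℝ → ℝ) : Prop :=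
  IntegrableOn v (Ioo 0 ℓ) volume ∧
  IntervalSobolev ℓ p u u' ∧
  (∀ᵐ x ∂(volume.restrict (Ioo 0 ℓ)), v x = γ (u x)) ∧
  ∀ φ φ' : ℝ → ℝ, IntervalSobolev ℓ p φ φ' →
    (∫ x in Ioo 0 ℓ, v x * φ x) + (∫ x in Ioo 0 ℓ, rho p (u' x) * φ' x)
    = (∫ x in Ioo 0 ℓ, f x * φ x) + a * φ 0 + b * φ ℓ

/-- `v` is a weak solution of the interval Neumann problem (P^{γ,f}_{p,a,b}). -/
def IsNeumannWeakSolution (ℓ p : ℝ) (γ f : ℝ → ℝ) (a b : ℝ) (v : ℝ → ℝ) : Prop :=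
  ∃ u u', SolvesNeumann ℓ p γ f a b v u u'

end

noncomputable section

/-- Legendre transform j*_γ of j_γ(r) = ∫₀^r γ(s) ds. -/
def jstar (γ : ℝ → ℝ) (s : ℝ) : ℝ :=
  ⨆ r : ℝ, (r * s - ∫ t in (0:ℝ)..r, γ t)

/-- `v` is a weak solution on [0,T] of the evolution problem
∂ₜ v_e = (ρ_{p_e}(∂ₓ u_e))' + f_e, v_e = γ_e(u_e), with continuity of u at the vertices,
Neumann–Kirchhoff flux data ω and initial datum v₀. -/
def IsEvolWeakSolution (G : MetricGraph) (p : G.E → ℝ) (γ : G.E → ℝ → ℝ)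
    (f : ℝ → G.E → ℝ → ℝ) (ω : ℝ → G.V → ℝ) (v₀ : G.E → ℝ → ℝ) (T : ℝ)
    (v : ℝ → G.E → ℝ → ℝ) : Prop :=
  (∀ t ∈ Icc (0:ℝ) T, ∀ e, IntegrableOn (v t e) (Ioo 0 (G.len e)) volume) ∧
  -- continuity for the L¹(G) norm
  (∀ s ∈ Icc (0:ℝ) T, Tendsto
    (fun t => edgeSum G (fun e => ∫ x in Ioo (0:ℝ) (G.len e), |v t e x - v s e x|))
    (nhdsWithin s (Icc 0 T)) (nhds 0)) ∧
  -- initial datum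
  (∀ e, ∀ᵐ x ∂(volume.restrict (Ioo 0 (G.len e))), v 0 e x = v₀ e x) ∧
  ∃ u u' : ℝ → G.E → ℝ → ℝ, ∃ uV : ℝ → G.V → ℝ,
    -- joint measurability in (t,x)
    (∀ e, AEStronglyMeasurable (fun q : ℝ × ℝ => u q.1 e q.2)
        ((volume : Measure (ℝ × ℝ)).restrict (Ioo (0:ℝ) T ×ˢ Ioo (0:ℝ) (G.len e)))) ∧
    -- u(t) ∈ W^{1,p̄}(G) for a.e. t
    (∀ᵐ t ∂(volume.restrict (Ioo (0:ℝ) T)), GraphSobolev G p (u t) (u' t) (uV t)) ∧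
    -- u_e, ∂ₓ u_e ∈ L^{p_e}((0,T)×(0,ℓ_e))
    (∀ e, IntegrableOn (fun q : ℝ × ℝ => |u q.1 e q.2| ^ p e)
        (Ioo (0:ℝ) T ×ˢ Ioo (0:ℝ) (G.len e)) volume) ∧
    (∀ e, IntegrableOn (fun q : ℝ × ℝ => |u' q.1 e q.2| ^ p e)
        (Ioo (0:ℝ) T ×ˢ Ioo (0:ℝ) (G.len e)) volume) ∧
    -- v = γ(u)
    (∀ t ∈ Icc (0:ℝ) T, ∀ e, ∀ᵐ x ∂(volume.restrict (Ioo 0 (G.len e))),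
      v t e x = γ e (u t e x)) ∧
    -- weak formulation against φ ∈ W^{1,p̄}(G) and ξ ∈ C_c^∞((0,T))
    (∀ φ φ' : G.E → ℝ → ℝ, ∀ φV : G.V → ℝ, GraphSobolev G p φ φ' φV →
      ∀ ξ : ℝ → ℝ, ContDiff ℝ (⊤ : ℕ∞) ξ → (∀ t, t ∉ Ioo (0:ℝ) T → ξ t = 0) →
      -(∫ t in Ioo (0:ℝ) T, deriv ξ t *
          edgeSum G (fun e => ∫ x in Ioo (0:ℝ) (G.len e), v t e x * φ e x))
        + (∫ t in Ioo (0:ℝ) T, ξ t *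
            edgeSum G (fun e => ∫ x in Ioo (0:ℝ) (G.len e), rho (p e) (u' t e x) * φ' e x))
      = (∫ t in Ioo (0:ℝ) T, ξ t *
            edgeSum G (fun e => ∫ x in Ioo (0:ℝ) (G.len e), f t e x * φ e x))
        + ∫ t in Ioo (0:ℝ) T, ξ t * vertexSum G (fun z => ω t z * φV z))

end

open Topology
open scoped ENNReal

attribute [local instance] MetricGraph.fintypeV MetricGraph.fintypeE

namespace IntervalSobolev

variable {ℓ p : ℝ} {u u' w w' : ℝ → ℝ}

lemma intervalIntegrable (hℓ : 0 < ℓ) (h : IntervalSobolev ℓ p u u') :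
    IntervalIntegrable u' volume 0 ℓ :=
  (intervalIntegrable_iff_integrableOn_Ioo_of_le hℓ.le).2 h.1

lemma absolutelyContinuous_primitive (hℓ : 0 < ℓ) (h : IntervalSobolev ℓ p u u') :
    AbsolutelyContinuousOnInterval (fun x => u 0 + ∫ t in (0:ℝ)..x, u' t) 0 ℓ :=
  AbsolutelyContinuousOnInterval.add
    (LipschitzOnWith.absolutelyContinuousOnInterval (K := 0)
      ((LipschitzWith.const (u 0)).lipschitzOnWith))
    ((h.intervalIntegrable hℓ).absolutelyContinuousOnInterval_intervalIntegral (by simp))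

lemma continuousOn (hℓ : 0 < ℓ) (h : IntervalSobolev ℓ p u u') : ContinuousOn u (Icc 0 ℓ) := by
  have := (h.absolutelyContinuous_primitive hℓ).continuousOn
  rw [uIcc_of_le hℓ.le] at this
  exact this.congr h.2.2

lemma exists_bound (hℓ : 0 < ℓ) (h : IntervalSobolev ℓ p u u') :
    ∃ C, ∀ x ∈ Icc 0 ℓ, |u x| ≤ C :=
  isCompact_Icc.exists_bound_of_continuousOn (h.continuousOn hℓ)

lemma ae_hasDerivAt_primitive (hℓ : 0 < ℓ) (h : IntervalSobolev ℓ p u u') :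
    ∀ᵐ x ∂(volume.restrict (Ioo 0 ℓ)),
      HasDerivAt (fun x => u 0 + ∫ t in (0:ℝ)..x, u' t) (u' x) x := by
  rw [ae_restrict_iff' measurableSet_Ioo]
  filter_upwards [(h.intervalIntegrable hℓ).ae_hasDerivAt_integral] with x hx hm
  refine (hx ?_ 0 (by simp)).const_add (u 0)
  rw [uIcc_of_le hℓ.le]
  exact Ioo_subset_Icc_self hm

lemma memLp (h : IntervalSobolev ℓ p u u') (hp : 0 < p) :
    MemLp u' (ENNReal.ofReal p) (volume.restrict (Ioo 0 ℓ)) := by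
  rw [← integrable_norm_rpow_iff h.1.aestronglyMeasurable (by simpa using hp) (by simp),
    ENNReal.toReal_ofReal hp.le]
  exact h.2.1

lemma of_memLp (hp : 1 ≤ p)
    (hm : MemLp u' (ENNReal.ofReal p) (volume.restrict (Ioo 0 ℓ)))
    (h : ∀ x ∈ Icc (0:ℝ) ℓ, u x = u 0 + ∫ t in (0:ℝ)..x, u' t) : IntervalSobolev ℓ p u u' := by
  refine ⟨hm.integrable (by simpa using hp), ?_, h⟩
  have := hm.integrable_norm_rpow (by simp; linarith) (by simp)
  rwa [ENNReal.toReal_ofReal (by linarith)] at this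

lemma congr (hℓ : 0 < ℓ) (h : IntervalSobolev ℓ p u u') (hu : ∀ x ∈ Icc 0 ℓ, w x = u x)
    (hu' : ∀ᵐ x ∂(volume.restrict (Ioo 0 ℓ)), w' x = u' x) : IntervalSobolev ℓ p w w' := by
  have hu'' : u' =ᵐ[volume.restrict (Ioo 0 ℓ)] w' := by
    filter_upwards [hu'] with x hx using hx.symm
  refine ⟨h.1.congr hu'', h.2.1.congr ?_, fun x hx => ?_⟩
  · filter_upwards [hu'] with x hx
    rw [hx]
  · rw [hu x hx, hu 0 (by simp [hℓ.le]), h.2.2 x hx]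
    congr 1
    apply intervalIntegral.integral_congr_ae
    rw [ae_restrict_iff' measurableSet_Ioo] at hu'
    have h1 : ∀ᵐ y : ℝ, y ≠ ℓ := by simp [ae_iff, measure_singleton]
    filter_upwards [hu', h1] with y hy hyl hym
    rw [uIoc_of_le hx.1] at hym
    exact (hy ⟨hym.1, lt_of_le_of_ne (hym.2.trans hx.2) hyl⟩).symm

lemma sub (hℓ : 0 < ℓ) (hp : 1 ≤ p) (h : IntervalSobolev ℓ p u u')
    (h₂ : IntervalSobolev ℓ p w w') :
    IntervalSobolev ℓ p (fun x => u x - w x) (fun x => u' x - w' x) := by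
  refine of_memLp hp ((h.memLp (by linarith)).sub (h₂.memLp (by linarith))) fun x hx => ?_
  have hs : uIcc 0 x ⊆ uIcc 0 ℓ := by
    rw [uIcc_of_le hx.1, uIcc_of_le hℓ.le]
    exact Icc_subset_Icc_right hx.2
  rw [intervalIntegral.integral_sub ((h.intervalIntegrable hℓ).mono_set hs)
    ((h₂.intervalIntegrable hℓ).mono_set hs), h.2.2 x hx, h₂.2.2 x hx]
  ring

lemma comp {N : ℝ → ℝ} {C : ℝ} (hN : ContDiff ℝ 1 N) (hC : ∀ r, |deriv N r| ≤ C)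
    (hℓ : 0 < ℓ) (hp : 1 ≤ p) (h : IntervalSobolev ℓ p u u') :
    IntervalSobolev ℓ p (fun x => N (u x)) (fun x => deriv N (u x) * u' x) := by
  have hNc : Continuous (deriv N) := hN.continuous_deriv le_rfl
  have hum : AEStronglyMeasurable u (volume.restrict (Ioo 0 ℓ)) :=
    ((h.continuousOn hℓ).mono Ioo_subset_Icc_self).aestronglyMeasurable measurableSet_Ioo
  refine of_memLp hp ?_ fun x hx => ?_
  · refine (h.memLp (by linarith)).of_le_mul (c := C)
      ((hNc.comp_aestronglyMeasurable hum).mul h.1.aestronglyMeasurable) (ae_of_all _ fun x => ?_)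
    rw [norm_mul]
    exact mul_le_mul_of_nonneg_right (hC _) (norm_nonneg _)
  · set g : ℝ → ℝ := fun x => u 0 + ∫ t in (0:ℝ)..x, u' t with hg
    have hac := h.absolutelyContinuous_primitive hℓ
    have hlip : LipschitzWith C.toNNReal N := by
      refine lipschitzWith_of_nnnorm_deriv_le (hN.differentiable one_ne_zero) fun r => ?_
      rw [← NNReal.coe_le_coe, coe_nnnorm, Real.coe_toNNReal']
      exact (hC r).trans (le_max_left _ _)
    have hacN : AbsolutelyContinuousOnInterval (fun x => N (g x)) 0 ℓ := by
      rw [absolutelyContinuousOnInterval_iff] at hac ⊢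
      intro ε hε
      obtain ⟨δ, hδ, H⟩ := hac (ε / (C.toNNReal + 1)) (by positivity)
      refine ⟨δ, hδ, fun E hE hE2 => ?_⟩
      calc _ ≤ ∑ i ∈ Finset.range E.1, C.toNNReal * dist (g (E.2 i).1) (g (E.2 i).2) :=
            Finset.sum_le_sum fun i _ => hlip.dist_le_mul _ _
        _ = C.toNNReal * ∑ i ∈ Finset.range E.1, dist (g (E.2 i).1) (g (E.2 i).2) := by
            rw [Finset.mul_sum]
        _ ≤ C.toNNReal * (ε / (C.toNNReal + 1)) := by
            gcongr
            exact (H E hE hE2).le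
        _ < (C.toNNReal + 1) * (ε / (C.toNNReal + 1)) := by gcongr; linarith
        _ = ε := by field_simp
    have hs : uIcc 0 x ⊆ uIcc 0 ℓ := by
      rw [uIcc_of_le hx.1, uIcc_of_le hℓ.le]
      exact Icc_subset_Icc_right hx.2
    have h1 := (hacN.mono hs).integral_deriv_eq_sub
    have h2 : ∫ y in (0:ℝ)..x, deriv (fun x => N (g x)) y = ∫ y in (0:ℝ)..x,
        deriv N (u y) * u' y := by
      apply intervalIntegral.integral_congr_ae
      have h3 := h.ae_hasDerivAt_primitive hℓ
      rw [ae_restrict_iff' measurableSet_Ioo] at h3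
      have h4 : ∀ᵐ y : ℝ, y ≠ ℓ := by simp [ae_iff, measure_singleton]
      filter_upwards [h3, h4] with y hy hyl hym
      rw [uIoc_of_le hx.1] at hym
      have hy' := hy ⟨hym.1, lt_of_le_of_ne (hym.2.trans hx.2) hyl⟩
      have := ((hN.differentiable one_ne_zero (g y)).hasDerivAt.comp y hy').deriv
      rw [h.2.2 y ⟨hym.1.le, hym.2.trans hx.2⟩]
      exact this
    rw [h2] at h1
    rw [h1, hg]
    simp only [intervalIntegral.integral_same, add_zero]
    rw [← h.2.2 x hx]
    ring

end IntervalSobolev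

lemma GraphSobolev.comp_sub {G : MetricGraph} {p : G.E → ℝ} (hp : ∀ e, 1 < p e)
    {u u' w w' : G.E → ℝ → ℝ} {uV wV : G.V → ℝ} (hu : GraphSobolev G p u u' uV)
    (hw : GraphSobolev G p w w' wV) {N : ℝ → ℝ} {C : ℝ} (hN : ContDiff ℝ 1 N)
    (hC : ∀ r, |deriv N r| ≤ C) :
    GraphSobolev G p (fun e x => N (u e x - w e x))
      (fun e x => deriv N (u e x - w e x) * (u' e x - w' e x)) (fun z => N (uV z - wV z)) := by
  refine ⟨fun e => ?_, fun e => ?_, fun e => ?_⟩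
  · exact ((hu.1 e).sub (G.len_pos e) (hp e).le (hw.1 e)).comp hN hC (G.len_pos e) (hp e).le
  · simp only [hu.2.1 e, hw.2.1 e]
  · simp only [hu.2.2 e, hw.2.2 e]

/-- Mean of `u t` on `(0, ℓ)` near `x`, weighted by a tent function of width `1 / (n + 1)`. -/
noncomputable def tentMean (ℓ : ℝ) (u : ℝ → ℝ → ℝ) (n : ℕ) (t x : ℝ) : ℝ :=
  (∫ y in Ioo 0 ℓ, max 0 (1 - (n + 1) * |y - x|) * u t y) /
    ∫ y in Ioo 0 ℓ, max 0 (1 - ((n:ℝ) + 1) * |y - x|)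

lemma measurable_tentMean (ℓ : ℝ) {u : ℝ → ℝ → ℝ} (hu : Measurable (Function.uncurry u)) (n : ℕ) :
    Measurable (Function.uncurry (tentMean ℓ u n)) := by
  have h1 : Measurable fun q : (ℝ × ℝ) × ℝ => max 0 (1 - ((n:ℝ) + 1) * |q.2 - q.1.2|) := by
    fun_prop
  have h2 : Measurable fun q : (ℝ × ℝ) × ℝ => u q.1.1 q.2 :=
    hu.comp (measurable_fst.fst.prodMk measurable_snd)
  exact (((h1.mul h2).stronglyMeasurable.integral_prod_right
    (ν := volume.restrict (Ioo 0 ℓ))).measurable).div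
    ((h1.stronglyMeasurable.integral_prod_right (ν := volume.restrict (Ioo 0 ℓ))).measurable)

lemma tendsto_tentMean {ℓ : ℝ} (hℓ : 0 < ℓ) {u : ℝ → ℝ → ℝ} {t : ℝ} {w : ℝ → ℝ}
    (hw : ContinuousOn w (Icc 0 ℓ)) (huw : ∀ᵐ x ∂(volume.restrict (Ioo 0 ℓ)), w x = u t x)
    {x : ℝ} (hx : x ∈ Icc 0 ℓ) :
    Tendsto (fun n => tentMean ℓ u n t x) atTop (𝓝 (w x)) := by
  rw [Metric.tendsto_atTop]
  intro ε hε
  obtain ⟨δ, hδ, hwδ⟩ := Metric.continuousWithinAt_iff.1 (hw x hx) (ε / 2) (by positivity)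
  obtain ⟨n₀, hn₀⟩ := exists_nat_gt (1 / δ)
  refine ⟨n₀, fun n hn => ?_⟩
  have hn1 : 1 / δ < (n:ℝ) + 1 := by
    have : (n₀:ℝ) ≤ n := by exact_mod_cast hn
    linarith
  have hnδ : 1 < ((n:ℝ) + 1) * δ := by
    rwa [div_lt_iff₀ hδ] at hn1
  set k : ℝ → ℝ := fun y => max 0 (1 - ((n:ℝ) + 1) * |y - x|) with hk
  have hkc : Continuous k := by fun_prop
  have hk0 : ∀ y, 0 ≤ k y := fun y => le_max_left _ _
  have hki : IntegrableOn k (Ioo 0 ℓ) :=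
    (hkc.integrableOn_Icc (a := 0) (b := ℓ)).mono_set Ioo_subset_Icc_self
  have hkwi : IntegrableOn (fun y => k y * w y) (Ioo 0 ℓ) :=
    ((hkc.continuousOn.mul hw).integrableOn_Icc).mono_set Ioo_subset_Icc_self
  have hden : 0 < ∫ y in Ioo 0 ℓ, k y := by
    rw [setIntegral_pos_iff_support_of_nonneg_ae (ae_of_all _ hk0) hki]
    have hn0 : (0:ℝ) < n + 1 := by positivity
    have hsub : Ioo (max 0 (x - 1 / (n + 1))) (min ℓ (x + 1 / (n + 1))) ⊆
        Function.support k ∩ Ioo 0 ℓ := by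
      intro y hy
      simp only [mem_Ioo, max_lt_iff, lt_min_iff] at hy
      refine ⟨?_, hy.1.1, hy.2.1⟩
      have : |y - x| < 1 / (n + 1) := abs_lt.2 ⟨by linarith, by linarith⟩
      rw [lt_div_iff₀ hn0] at this
      have : 0 < k y := lt_max_of_lt_right (by linarith)
      exact this.ne'
    refine lt_of_lt_of_le ?_ (measure_mono hsub)
    rw [Real.volume_Ioo, ENNReal.ofReal_pos, sub_pos]
    have : (0:ℝ) < 1 / (n + 1) := by positivity
    simp only [lt_min_iff, max_lt_iff]
    exact ⟨⟨hℓ, by linarith [hx.2]⟩, by linarith [hx.1], by linarith⟩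
  have hnum : ∫ y in Ioo 0 ℓ, k y * u t y = ∫ y in Ioo 0 ℓ, k y * w y := by
    apply integral_congr_ae
    filter_upwards [huw] with y hy
    rw [hy]
  have hdiff : |(∫ y in Ioo 0 ℓ, k y * w y) - w x * ∫ y in Ioo 0 ℓ, k y| ≤
      ε / 2 * ∫ y in Ioo 0 ℓ, k y := by
    rw [← integral_const_mul, ← integral_const_mul, ← integral_sub hkwi (hki.const_mul _),
      ← Real.norm_eq_abs]
    refine norm_integral_le_of_norm_le (hki.const_mul _) ?_
    rw [ae_restrict_iff' measurableSet_Ioo]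
    refine ae_of_all _ fun y hy => ?_
    rw [show k y * w y - w x * k y = (w y - w x) * k y by ring, norm_mul, Real.norm_eq_abs (k y),
      abs_of_nonneg (hk0 y)]
    by_cases hyx : |y - x| < δ
    · refine mul_le_mul_of_nonneg_right ?_ (hk0 y)
      exact (hwδ (Ioo_subset_Icc_self hy) hyx).le
    · have : k y = 0 := by
        refine max_eq_left ?_
        nlinarith [not_lt.1 hyx]
      simp [this]
  have heq : tentMean ℓ u n t x - w x =
      ((∫ y in Ioo 0 ℓ, k y * w y) - w x * ∫ y in Ioo 0 ℓ, k y) / ∫ y in Ioo 0 ℓ, k y := by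
    rw [sub_div, mul_div_cancel_right₀ _ hden.ne', ← hnum]
    rfl
  rw [Real.dist_eq, heq, abs_div, abs_of_pos hden, div_lt_iff₀ hden]
  exact hdiff.trans_lt (by nlinarith)

/-- Upper limit of difference quotients in the second variable. -/
noncomputable def limsupSlope (U : ℝ → ℝ → ℝ) (t x : ℝ) : ℝ :=
  limsup (fun n : ℕ => ((n:ℝ) + 1) * (U t (x + 1 / ((n:ℝ) + 1)) - U t x)) atTop

lemma measurable_limsupSlope {U : ℝ → ℝ → ℝ} (hU : Measurable (Function.uncurry U)) :
    Measurable (Function.uncurry (limsupSlope U)) := by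
  have h : ∀ n : ℕ, Measurable fun q : ℝ × ℝ =>
      ((n:ℝ) + 1) * (U q.1 (q.2 + 1 / ((n:ℝ) + 1)) - U q.1 q.2) := fun n => by
    have h1 : Measurable fun q : ℝ × ℝ => U q.1 (q.2 + 1 / ((n:ℝ) + 1)) :=
      hU.comp (measurable_fst.prodMk (measurable_snd.add_const _))
    have h2 : Measurable fun q : ℝ × ℝ => U q.1 q.2 := hU
    exact (h1.sub h2).const_mul _
  exact Measurable.limsup h

/-- A function that is jointly measurable up to null sets and Sobolev in space for almost every
time has a jointly measurable version with a jointly measurable spatial derivative. -/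
lemma exists_measurable_version {ℓ p T : ℝ} (hℓ : 0 < ℓ) {u u' : ℝ → ℝ → ℝ}
    (hm : AEStronglyMeasurable (fun q : ℝ × ℝ => u q.1 q.2)
      ((volume : Measure (ℝ × ℝ)).restrict (Ioo (0:ℝ) T ×ˢ Ioo (0:ℝ) ℓ)))
    (hs : ∀ᵐ t ∂(volume.restrict (Ioo (0:ℝ) T)), IntervalSobolev ℓ p (u t) (u' t)) :
    ∃ U D : ℝ → ℝ → ℝ, Measurable (Function.uncurry U) ∧ Measurable (Function.uncurry D) ∧
      ∀ᵐ t ∂(volume.restrict (Ioo (0:ℝ) T)), (∀ x ∈ Icc 0 ℓ, U t x = u t x) ∧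
        ∀ᵐ x ∂(volume.restrict (Ioo 0 ℓ)), D t x = u' t x := by
  obtain ⟨g₀, hg₀, hug⟩ := hm
  rw [Measure.volume_eq_prod, ← Measure.prod_restrict] at hug
  set g : ℝ → ℝ → ℝ := fun t x => g₀ (t, x) with hg
  have hgm : Measurable (Function.uncurry g) := hg₀.measurable
  have hgu : ∀ᵐ t ∂(volume.restrict (Ioo (0:ℝ) T)), ∀ᵐ x ∂(volume.restrict (Ioo 0 ℓ)),
      u t x = g t x := Measure.ae_ae_of_ae_prod hug
  obtain ⟨U, hUm, hUl⟩ : ∃ U : ℝ → ℝ → ℝ, Measurable (Function.uncurry U) ∧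
      ∀ t x c, Tendsto (fun n => tentMean ℓ g n t x) atTop (𝓝 c) → U t x = c :=
    ⟨fun t x => limsup (fun n => tentMean ℓ g n t x) atTop,
      Measurable.limsup (f := fun n => Function.uncurry (tentMean ℓ g n))
        fun n => measurable_tentMean ℓ hgm n, fun t x c h => h.limsup_eq⟩
  refine ⟨U, limsupSlope U, hUm, measurable_limsupSlope hUm, ?_⟩
  filter_upwards [hgu, hs] with t ht hst
  have hUu : ∀ x ∈ Icc 0 ℓ, U t x = u t x := fun x hx =>
    hUl _ _ _ (tendsto_tentMean hℓ (hst.continuousOn hℓ) ht hx)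
  refine ⟨hUu, ?_⟩
  filter_upwards [hst.ae_hasDerivAt_primitive hℓ, ae_restrict_mem measurableSet_Ioo] with x hx hxm
  have h0 : Tendsto (fun n : ℕ => 1 / ((n:ℝ) + 1)) atTop (𝓝 0) :=
    tendsto_one_div_add_atTop_nhds_zero_nat
  have h1 : Tendsto (fun n : ℕ => 1 / ((n:ℝ) + 1)) atTop (𝓝[≠] 0) :=
    tendsto_nhdsWithin_iff.2 ⟨h0, Eventually.of_forall fun n => by
      have : (0:ℝ) < 1 / ((n:ℝ) + 1) := by positivity
      exact this.ne'⟩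
  have h2 := (hasDerivAt_iff_tendsto_slope_zero.1 hx).comp h1
  refine Tendsto.limsup_eq (h2.congr' ?_)
  have h3 : ∀ᶠ n : ℕ in atTop, 1 / ((n:ℝ) + 1) < ℓ - x := h0.eventually_lt_const (by linarith [hxm.2])
  filter_upwards [h3] with n hn
  have hpos : (0:ℝ) < 1 / ((n:ℝ) + 1) := by positivity
  have hm1 : x + 1 / ((n:ℝ) + 1) ∈ Icc 0 ℓ := ⟨by linarith [hxm.1], by linarith⟩
  simp only [Function.comp_apply, smul_eq_mul, one_div, inv_inv] at hm1 ⊢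
  rw [hUu _ hm1, hUu x (Ioo_subset_Icc_self hxm), hst.2.2 _ hm1,
    hst.2.2 _ (Ioo_subset_Icc_self hxm)]

lemma deriv_smoothTransition_eq_zero {r : ℝ} (hr : r < 0 ∨ 1 < r) :
    deriv Real.smoothTransition r = 0 := by
  rcases hr with hr | hr
  · have : Real.smoothTransition =ᶠ[𝓝 r] fun _ => 0 := by
      filter_upwards [gt_mem_nhds hr] with y hy using Real.smoothTransition.zero_of_nonpos hy.le
    rw [this.deriv_eq, deriv_const]
  · have : Real.smoothTransition =ᶠ[𝓝 r] fun _ => 1 := by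
      filter_upwards [lt_mem_nhds hr] with y hy using Real.smoothTransition.one_of_one_le hy.le
    rw [this.deriv_eq, deriv_const]

lemma differentiable_smoothTransition : Differentiable ℝ Real.smoothTransition :=
  (Real.smoothTransition.contDiff (n := 1)).differentiable one_ne_zero

lemma continuous_deriv_smoothTransition : Continuous (deriv Real.smoothTransition) :=
  (Real.smoothTransition.contDiff (n := 1)).continuous_deriv le_rfl

lemma deriv_ramp (c a t : ℝ) :
    deriv (fun t => Real.smoothTransition (c * (t - a))) t =
      c * deriv Real.smoothTransition (c * (t - a)) := by
  have h : HasDerivAt (fun t => c * (t - a)) c t := by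
    simpa using ((hasDerivAt_id t).sub_const a).const_mul c
  have := (differentiable_smoothTransition (c * (t - a))).hasDerivAt.comp t h
  rw [mul_comm]
  exact this.deriv

lemma tendsto_integral_deriv_ramp_mul {m : ℝ → ℝ} {T a : ℝ} (hm : ContinuousOn m (Icc 0 T))
    (ha : a ∈ Ioo 0 T) :
    Tendsto (fun n : ℕ => ∫ t in Ioo 0 T,
      deriv (fun t => Real.smoothTransition ((n:ℝ) * (t - a))) t * m t) atTop (𝓝 (m a)) := by
  rw [Metric.tendsto_atTop]
  intro ε hε
  obtain ⟨δ', hδ', hmδ⟩ := Metric.continuousWithinAt_iff.1 (hm a (Ioo_subset_Icc_self ha))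
    (ε / 2) (by positivity)
  set δ := min δ' (min a (T - a)) with hδd
  have hδ : 0 < δ := lt_min hδ' (lt_min ha.1 (by linarith [ha.2]))
  have hδa : δ ≤ a := (min_le_right _ _).trans (min_le_left _ _)
  have hδT : δ ≤ T - a := (min_le_right _ _).trans (min_le_right _ _)
  obtain ⟨n₀, hn₀⟩ := exists_nat_gt (1 / δ)
  refine ⟨n₀, fun n hn => ?_⟩
  have hn1 : 1 / δ < (n:ℝ) := by
    have : (n₀:ℝ) ≤ n := by exact_mod_cast hn
    linarith
  have hnδ : 1 < (n:ℝ) * δ := by rwa [div_lt_iff₀ hδ] at hn1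
  have hT : (0:ℝ) ≤ T := (ha.1.trans ha.2).le
  set S : ℝ → ℝ := fun t => Real.smoothTransition ((n:ℝ) * (t - a)) with hS
  have hSc : ContDiff ℝ 1 S := Real.smoothTransition.contDiff.comp (by fun_prop)
  have hkc : Continuous (deriv S) := hSc.continuous_deriv le_rfl
  have hk0 : ∀ t, 0 ≤ deriv S t := fun t => by
    rw [hS, deriv_ramp]
    exact mul_nonneg (by positivity) (Real.smoothTransition.monotone.deriv_nonneg)
  have hki : IntegrableOn (deriv S) (Ioo 0 T) :=
    (hkc.integrableOn_Icc (a := 0) (b := T)).mono_set Ioo_subset_Icc_self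
  have hkmi : IntegrableOn (fun y => deriv S y * m y) (Ioo 0 T) :=
    ((hkc.continuousOn.mul hm).integrableOn_Icc).mono_set Ioo_subset_Icc_self
  have hone : ∫ t in Ioo 0 T, deriv S t = 1 := by
    rw [← integral_Ioc_eq_integral_Ioo, ← intervalIntegral.integral_of_le hT,
      intervalIntegral.integral_deriv_eq_sub (fun x _ => hSc.differentiable one_ne_zero x)
        (hkc.intervalIntegrable _ _)]
    simp only [hS]
    rw [Real.smoothTransition.one_of_one_le (by nlinarith),
      Real.smoothTransition.zero_of_nonpos (by nlinarith [(Nat.cast_nonneg n : (0:ℝ) ≤ n), ha.1])]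
    simp
  have hdiff : |(∫ y in Ioo 0 T, deriv S y * m y) - m a * ∫ y in Ioo 0 T, deriv S y| ≤
      ε / 2 * ∫ y in Ioo 0 T, deriv S y := by
    rw [← integral_const_mul, ← integral_const_mul, ← integral_sub hkmi (hki.const_mul _),
      ← Real.norm_eq_abs]
    refine norm_integral_le_of_norm_le (hki.const_mul _) ?_
    rw [ae_restrict_iff' measurableSet_Ioo]
    refine ae_of_all _ fun y hy => ?_
    rw [show deriv S y * m y - m a * deriv S y = (m y - m a) * deriv S y by ring, norm_mul,
      Real.norm_eq_abs (deriv S y), abs_of_nonneg (hk0 y)]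
    by_cases hyx : |y - a| < δ
    · refine mul_le_mul_of_nonneg_right ?_ (hk0 y)
      exact (hmδ (Ioo_subset_Icc_self hy) (hyx.trans_le (min_le_left _ _))).le
    · have : deriv S y = 0 := by
        rw [hS, deriv_ramp, deriv_smoothTransition_eq_zero, mul_zero]
        have hn0 : (0:ℝ) < n := (by positivity : (0:ℝ) < 1 / δ).trans hn1
        rcases le_abs'.1 (not_lt.1 hyx) with h | h
        · left; nlinarith
        · right; nlinarith
      simp [this]
  rw [hone, mul_one, mul_one] at hdiff
  rw [Real.dist_eq]
  exact hdiff.trans_lt (by linarith)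

/-- A distributional equation `m' = L` on `(0, T)` with `m` continuous holds in integrated form. -/
lemma sub_eq_integral_of_weak_deriv {m L : ℝ → ℝ} {T : ℝ} (hm : ContinuousOn m (Icc 0 T))
    (hL : IntegrableOn L (Ioo 0 T))
    (H : ∀ ξ : ℝ → ℝ, ContDiff ℝ (⊤ : ℕ∞) ξ → (∀ t, t ∉ Ioo (0:ℝ) T → ξ t = 0) →
      -(∫ t in Ioo 0 T, deriv ξ t * m t) = ∫ t in Ioo 0 T, ξ t * L t)
    {a b : ℝ} (ha : 0 < a) (hab : a < b) (hb : b < T) :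
    m b - m a = ∫ t in Ioo a b, L t := by
  have hda := tendsto_integral_deriv_ramp_mul hm ⟨ha, hab.trans hb⟩
  have hdb := tendsto_integral_deriv_ramp_mul hm ⟨ha.trans hab, hb⟩
  set ξ : ℕ → ℝ → ℝ := fun n t =>
    Real.smoothTransition ((n:ℝ) * (t - a)) - Real.smoothTransition ((n:ℝ) * (t - b)) with hξ
  have hcd : ∀ c : ℝ, ∀ n : ℕ, ContDiff ℝ (⊤ : ℕ∞) fun t =>
      Real.smoothTransition ((n:ℝ) * (t - c)) := fun c n =>
    Real.smoothTransition.contDiff.comp (by fun_prop)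
  have hi : ∀ c : ℝ, ∀ n : ℕ, IntegrableOn (fun t =>
      deriv (fun t => Real.smoothTransition ((n:ℝ) * (t - c))) t * m t) (Ioo 0 T) := fun c n =>
    ((((hcd c n).continuous_deriv (by simp)).continuousOn.mul hm).integrableOn_Icc).mono_set
      Ioo_subset_Icc_self
  have hleft : Tendsto (fun n => -(∫ t in Ioo 0 T, deriv (ξ n) t * m t)) atTop
      (𝓝 (-(m a - m b))) := by
    refine ((hda.sub hdb).congr fun n => ?_).neg
    rw [← integral_sub (hi a n) (hi b n)]
    congr 1
    ext t
    rw [hξ]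
    simp only
    rw [deriv_fun_sub ((hcd a n).differentiable (by simp) t)
      ((hcd b n).differentiable (by simp) t), sub_mul]
  have hright : Tendsto (fun n => ∫ t in Ioo 0 T, ξ n t * L t) atTop
      (𝓝 (∫ t in Ioo 0 T, (Ioc a b).indicator (fun _ => (1:ℝ)) t * L t)) := by
    refine tendsto_integral_of_dominated_convergence (fun t => 1 * |L t|)
      (fun n => (((hcd a n).continuous.sub (hcd b n).continuous).aestronglyMeasurable).mul
        hL.aestronglyMeasurable) (hL.abs.const_mul 1) (fun n => ae_of_all _ fun t => ?_)
      (ae_of_all _ fun t => ?_)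
    · rw [norm_mul]
      refine mul_le_mul_of_nonneg_right ?_ (norm_nonneg _)
      rw [Real.norm_eq_abs, abs_le]
      constructor <;>
      linarith [Real.smoothTransition.nonneg ((n:ℝ) * (t - a)),
        Real.smoothTransition.le_one ((n:ℝ) * (t - a)),
        Real.smoothTransition.nonneg ((n:ℝ) * (t - b)),
        Real.smoothTransition.le_one ((n:ℝ) * (t - b))]
    · refine Tendsto.mul_const _ ?_
      have key : ∀ c : ℝ, Tendsto (fun n : ℕ => Real.smoothTransition ((n:ℝ) * (t - c))) atTop
          (𝓝 ((Ioi c).indicator (fun _ => (1:ℝ)) t)) := by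
        intro c
        by_cases hc : c < t
        · rw [indicator_of_mem (by exact hc)]
          refine tendsto_const_nhds.congr' ?_
          have h1 : Tendsto (fun n : ℕ => (n:ℝ) * (t - c)) atTop atTop :=
            tendsto_natCast_atTop_atTop.atTop_mul_const (by linarith)
          filter_upwards [h1.eventually_ge_atTop 1] with n hn
          exact (Real.smoothTransition.one_of_one_le hn).symm
        · rw [indicator_of_notMem (by exact hc)]
          refine tendsto_const_nhds.congr fun n => ?_
          exact (Real.smoothTransition.zero_of_nonpos
            (mul_nonpos_of_nonneg_of_nonpos (by positivity) (by linarith))).symm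
      convert (key a).sub (key b) using 2
      by_cases h1 : a < t <;> by_cases h2 : b < t <;> simp [indicator, h1, h2] <;> linarith
  have hev : ∀ᶠ n : ℕ in atTop,
      -(∫ t in Ioo 0 T, deriv (ξ n) t * m t) = ∫ t in Ioo 0 T, ξ n t * L t := by
    have h1 : Tendsto (fun n : ℕ => (n:ℝ) * (T - b)) atTop atTop :=
      tendsto_natCast_atTop_atTop.atTop_mul_const (by linarith)
    filter_upwards [h1.eventually_ge_atTop 1] with n hn
    refine H (ξ n) ((hcd a n).sub (hcd b n)) fun t ht => ?_
    have hn0 : (0:ℝ) ≤ n := by positivity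
    simp only [mem_Ioo, not_and_or, not_lt] at ht
    simp only [hξ]
    rcases ht with ht | ht
    · rw [Real.smoothTransition.zero_of_nonpos (by nlinarith),
        Real.smoothTransition.zero_of_nonpos (by nlinarith), sub_zero]
    · rw [Real.smoothTransition.one_of_one_le (by nlinarith),
        Real.smoothTransition.one_of_one_le (by nlinarith), sub_self]
  have := tendsto_nhds_unique (hleft.congr' hev) hright
  rw [neg_sub] at this
  rw [this]
  have h2 : (fun t => (Ioc a b).indicator (fun _ => (1:ℝ)) t * L t) = (Ioc a b).indicator L := by
    ext t
    by_cases h : t ∈ Ioc a b <;> simp [h]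
  have h3 : Ioc a b ⊆ Ioo 0 T := fun t ht => ⟨ha.trans ht.1, ht.2.trans_lt hb⟩
  rw [h2, setIntegral_indicator measurableSet_Ioc, inter_eq_right.2 h3,
    integral_Ioc_eq_integral_Ioo]

/-- The shift of the first coordinate by `-θ`, as a continuous map. -/
noncomputable def fstShift (θ : ℝ) : C(ℝ × ℝ, ℝ × ℝ) := ⟨fun z => (z.1 - θ, z.2), by fun_prop⟩

lemma continuous_fstShift : Continuous fstShift :=
  ContinuousMap.continuous_of_continuous_uncurry _ (by unfold fstShift; simp only [ContinuousMap.coe_mk, Function.uncurry_def]; fun_prop)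

lemma measurePreserving_fstShift (ν : Measure ℝ) [IsFiniteMeasure ν] (θ : ℝ) :
    MeasurePreserving (fstShift θ) (volume.prod ν) (volume.prod ν) :=
  (measurePreserving_sub_right volume θ).prod (MeasurePreserving.id ν)

lemma continuous_toLp_fstShift {ν : Measure ℝ} [IsFiniteMeasure ν] {q : ℝ≥0∞} [Fact (1 ≤ q)]
    (hq : q ≠ ∞) {K : ℝ × ℝ → ℝ} (hK : MemLp K q (volume.prod ν)) :
    Continuous fun θ => (hK.comp_measurePreserving (measurePreserving_fstShift ν θ)).toLp :=
  Continuous.compMeasurePreservingLp (f := fun _ => hK.toLp) continuous_const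
    continuous_fstShift (measurePreserving_fstShift ν) hq

lemma continuous_integral_shift_mul {ν : Measure ℝ} [IsFiniteMeasure ν] {q q' : ℝ≥0∞}
    [Fact (1 ≤ q)] [Fact (1 ≤ q')] [q.HolderConjugate q'] (hq : q ≠ ∞) {K φ : ℝ × ℝ → ℝ}
    (hK : MemLp K q (volume.prod ν)) (hφ : MemLp φ q' (volume.prod ν)) :
    Continuous fun θ => ∫ z, K (z.1 - θ, z.2) * φ z ∂(volume.prod ν) := by
  have h := ((ContinuousLinearMap.mul ℝ ℝ).lpPairing (volume.prod ν) q q').continuous.comp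
    (continuous_toLp_fstShift hq hK)
  have h2 := h.clm_apply (continuous_const (y := hφ.toLp))
  refine h2.congr fun θ => ?_
  simp only [Function.comp_apply, ContinuousLinearMap.lpPairing_eq_integral]
  refine integral_congr_ae ?_
  filter_upwards [(hK.comp_measurePreserving (measurePreserving_fstShift ν θ)).coeFn_toLp,
    hφ.coeFn_toLp] with z h1 h2
  rw [ContinuousLinearMap.mul_apply', h1, h2]
  rfl

lemma continuous_integral_abs_shift_sub {ν : Measure ℝ} [IsFiniteMeasure ν] {K K' : ℝ × ℝ → ℝ}
    (hK : Integrable K (volume.prod ν)) (hK' : Integrable K' (volume.prod ν)) :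
    Continuous fun θ => ∫ z, |K (z.1 - θ, z.2) - K' z| ∂(volume.prod ν) := by
  have hK1 := memLp_one_iff_integrable.2 hK
  have hK1' := memLp_one_iff_integrable.2 hK'
  have h := ((continuous_toLp_fstShift (by simp) hK1).sub (continuous_const (y := hK1'.toLp))).norm
  refine h.congr fun θ => ?_
  rw [Pi.sub_apply, ← MemLp.toLp_sub, L1.norm_eq_integral_norm]
  refine integral_congr_ae ?_
  filter_upwards [((hK1.comp_measurePreserving (measurePreserving_fstShift ν θ)).sub
    hK1').coeFn_toLp] with z h1
  rw [h1]
  rfl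

/-- The kernel `Λ` may be evaluated on translates of the diagonal, with the translates converging
to the diagonal value in the mean over `(a,b)`. -/
def DiagonalRegular (a b : ℝ) (Λ : ℝ → ℝ → ℝ) : Prop :=
  Integrable (fun q : ℝ × ℝ => Λ (q.2 - q.1) q.2)
    ((volume.restrict (Ioo 0 a)).prod (volume.restrict (Ioo a b))) ∧
  (∀ θ ∈ Ico 0 a, IntegrableOn (fun t => Λ (t - θ) t) (Ioo a b)) ∧
  Tendsto (fun θ => ∫ t in Ioo a b, Λ (t - θ) t) (𝓝[>] 0) (𝓝 (∫ t in Ioo a b, Λ t t))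

namespace DiagonalRegular

variable {a b : ℝ} {Λ Λ' : ℝ → ℝ → ℝ}

lemma integrableOn_diag (ha : 0 < a) (h : DiagonalRegular a b Λ) :
    IntegrableOn (fun t => Λ t t) (Ioo a b) := by
  simpa using h.2.1 0 ⟨le_rfl, ha⟩

lemma zero : DiagonalRegular a b (fun _ _ => 0) := by
  refine ⟨integrable_zero _ _ _, fun _ _ => integrable_zero _ _ _, ?_⟩
  simp

lemma neg (h : DiagonalRegular a b Λ) : DiagonalRegular a b (fun τ t => - Λ τ t) := by
  refine ⟨h.1.neg, fun θ hθ => (h.2.1 θ hθ).neg, ?_⟩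
  simpa only [integral_neg] using h.2.2.neg

lemma add (ha : 0 < a) (h : DiagonalRegular a b Λ) (h' : DiagonalRegular a b Λ') :
    DiagonalRegular a b (fun τ t => Λ τ t + Λ' τ t) := by
  refine ⟨h.1.add h'.1, fun θ hθ => (h.2.1 θ hθ).add (h'.2.1 θ hθ), ?_⟩
  rw [integral_add (h.integrableOn_diag ha) (h'.integrableOn_diag ha)]
  refine (h.2.2.add h'.2.2).congr' ?_
  filter_upwards [Ioo_mem_nhdsGT ha] with θ hθ
  rw [integral_add (h.2.1 θ ⟨hθ.1.le, hθ.2⟩) (h'.2.1 θ ⟨hθ.1.le, hθ.2⟩)]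

lemma sum {ι : Type*} (s : Finset ι) {Λ : ι → ℝ → ℝ → ℝ} (ha : 0 < a)
    (h : ∀ i ∈ s, DiagonalRegular a b (Λ i)) :
    DiagonalRegular a b (fun τ t => ∑ i ∈ s, Λ i τ t) := by
  classical
  induction s using Finset.induction_on with
  | empty => simpa using zero
  | insert i s hi ih =>
    simp only [Finset.sum_insert hi]
    exact add ha (h i (by simp)) (ih fun j hj => h j (by simp [hj]))

lemma const_left {g : ℝ → ℝ} (hg : IntegrableOn g (Ioo a b)) :
    DiagonalRegular a b (fun _ t => g t) :=
  ⟨Integrable.comp_snd hg _, fun _ _ => hg, tendsto_const_nhds⟩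

lemma of_integrand {ν : Measure ℝ} [IsFiniteMeasure ν] (ha : 0 < a) {H : ℝ → ℝ × ℝ → ℝ} {C : ℝ}
    (hm : Measurable (Function.uncurry H))
    (hi : ∀ θ ∈ Ico 0 a, Integrable (H θ) ((volume.restrict (Ioo a b)).prod ν))
    (hC : ∀ θ ∈ Ico 0 a, ∫ z, ‖H θ z‖ ∂((volume.restrict (Ioo a b)).prod ν) ≤ C)
    (ht : Tendsto (fun θ => ∫ z, H θ z ∂((volume.restrict (Ioo a b)).prod ν)) (𝓝[>] 0)
      (𝓝 (∫ z, H 0 z ∂((volume.restrict (Ioo a b)).prod ν))))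
    (hΛ : ∀ θ ∈ Ico 0 a, ∀ t ∈ Ioo a b, Λ (t - θ) t = ∫ x, H θ (t, x) ∂ν) :
    DiagonalRegular a b Λ := by
  have heq : ∀ θ ∈ Ico 0 a, (∫ z, H θ z ∂((volume.restrict (Ioo a b)).prod ν)) =
      ∫ t in Ioo a b, Λ (t - θ) t := by
    intro θ hθ
    rw [integral_prod _ (hi θ hθ)]
    exact setIntegral_congr_fun measurableSet_Ioo fun t h => (hΛ θ hθ t h).symm
  refine ⟨?_, fun θ hθ => ?_, ?_⟩
  · have hbig : Integrable (Function.uncurry H)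
        ((volume.restrict (Ioo 0 a)).prod ((volume.restrict (Ioo a b)).prod ν)) := by
      rw [integrable_prod_iff hm.aestronglyMeasurable]
      have hmem := ae_restrict_mem (μ := (volume : Measure ℝ)) (measurableSet_Ioo (a := 0) (b := a))
      constructor
      · filter_upwards [hmem] with θ hθ
        exact hi θ ⟨hθ.1.le, hθ.2⟩
      · refine Integrable.of_bound (C := C)
          hm.stronglyMeasurable.norm.integral_prod_right'.aestronglyMeasurable ?_
        filter_upwards [hmem] with θ hθ
        rw [Real.norm_of_nonneg (integral_nonneg fun z => norm_nonneg _)]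
        exact hC θ ⟨hθ.1.le, hθ.2⟩
    have hmp := measurePreserving_prodAssoc (volume.restrict (Ioo 0 a))
      ((volume : Measure ℝ).restrict (Ioo a b)) ν
    refine (((hmp.integrable_comp_emb (MeasurableEquiv.measurableEmbedding _)).2
      hbig).integral_prod_left).congr ?_
    rw [Measure.prod_restrict]
    filter_upwards [ae_restrict_mem (measurableSet_Ioo.prod measurableSet_Ioo)] with w hw
    exact (hΛ w.1 ⟨hw.1.1.le, hw.1.2⟩ w.2 hw.2).symm
  · refine (hi θ hθ).integral_prod_left.congr ?_
    filter_upwards [ae_restrict_mem measurableSet_Ioo] with t h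
    exact (hΛ θ hθ t h).symm
  · have h0 := heq 0 ⟨le_rfl, ha⟩
    simp only [sub_zero] at h0
    rw [h0] at ht
    refine ht.congr' ?_
    filter_upwards [Ioo_mem_nhdsGT ha] with θ hθ
    exact heq θ ⟨hθ.1.le, hθ.2⟩

lemma pairing {ν : Measure ℝ} [IsFiniteMeasure ν] {q q' : ℝ≥0∞} [Fact (1 ≤ q)] [Fact (1 ≤ q')]
    [q.HolderConjugate q'] (hq : q ≠ ∞) {T : ℝ} (ha : 0 < a) (hbT : b ≤ T) {K φ : ℝ × ℝ → ℝ}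
    (hKm : Measurable K) (hφm : Measurable φ)
    (hK : MemLp K q ((volume.restrict (Ioo 0 T)).prod ν))
    (hφ : MemLp φ q' ((volume.restrict (Ioo a b)).prod ν)) :
    DiagonalRegular a b (fun τ t => ∫ x, K (τ, x) * φ (t, x) ∂ν) := by
  have hA : MeasurableSet (Ioo 0 T ×ˢ (univ : Set ℝ)) := measurableSet_Ioo.prod .univ
  have hB : MeasurableSet (Ioo a b ×ˢ (univ : Set ℝ)) := measurableSet_Ioo.prod .univ
  set K₁ := (Ioo 0 T ×ˢ univ).indicator K with hK₁
  have hK₁L : MemLp K₁ q (volume.prod ν) := by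
    rwa [hK₁, memLp_indicator_iff_restrict hA, ← Measure.restrict_prod_eq_prod_univ]
  have hφ₁L : MemLp ((Ioo a b ×ˢ univ).indicator φ) q' (volume.prod ν) := by
    rwa [memLp_indicator_iff_restrict hB, ← Measure.restrict_prod_eq_prod_univ]
  have hpt : ∀ θ z, K₁ (z.1 - θ, z.2) * (Ioo a b ×ˢ univ).indicator φ z =
      (Ioo a b ×ˢ univ).indicator (fun z => K₁ (z.1 - θ, z.2) * φ z) z := fun θ z =>
    (indicator_mul_right (Ioo a b ×ˢ univ) (fun z : ℝ × ℝ => K₁ (z.1 - θ, z.2)) φ).symm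
  have hcont : Continuous fun θ => ∫ z, K₁ (z.1 - θ, z.2) * φ z
      ∂((volume.restrict (Ioo a b)).prod ν) := by
    refine (continuous_integral_shift_mul hq hK₁L hφ₁L).congr fun θ => ?_
    simp_rw [hpt]
    rw [integral_indicator hB, Measure.restrict_prod_eq_prod_univ]
  have hcontabs : Continuous fun θ => ∫ z, ‖K₁ (z.1 - θ, z.2) * φ z‖
      ∂((volume.restrict (Ioo a b)).prod ν) := by
    refine (continuous_integral_shift_mul hq hK₁L.norm hφ₁L.norm).congr fun θ => ?_
    simp_rw [← norm_mul, hpt, norm_indicator_eq_indicator_norm]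
    rw [integral_indicator hB, Measure.restrict_prod_eq_prod_univ]
  obtain ⟨C, hC⟩ := isCompact_Icc.exists_bound_of_continuousOn
    (hcontabs.continuousOn (s := Icc 0 a))
  refine of_integrand (C := C) (H := fun θ z => K₁ (z.1 - θ, z.2) * φ z) ha
    (((hKm.indicator hA).comp (by fun_prop)).mul (hφm.comp (by fun_prop))) (fun θ _ => ?_)
    (fun θ hθ => (le_abs_self _).trans (hC θ ⟨hθ.1, hθ.2.le⟩))
    ((hcont.tendsto 0).mono_left nhdsWithin_le_nhds) fun θ hθ t ht => ?_
  · have h1 := (hK₁L.comp_measurePreserving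
      (measurePreserving_fstShift ν θ)).integrable_mul hφ₁L
    have h2 : Integrable ((Ioo a b ×ˢ univ).indicator (fun z => K₁ (z.1 - θ, z.2) * φ z))
        (volume.prod ν) := h1.congr (ae_of_all _ (hpt θ))
    rwa [integrable_indicator_iff hB, IntegrableOn, ← Measure.restrict_prod_eq_prod_univ] at h2
  · refine integral_congr_ae (ae_of_all _ fun x => ?_)
    simp only [hK₁]
    rw [indicator_of_mem (by exact ⟨⟨by linarith [ht.1, hθ.2], by linarith [ht.2, hθ.1]⟩, trivial⟩)]

lemma abs_sub {ν : Measure ℝ} [IsFiniteMeasure ν] {T : ℝ} (ha : 0 < a) (hbT : b ≤ T)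
    {K : ℝ × ℝ → ℝ} (hKm : Measurable K) (hK : Integrable K ((volume.restrict (Ioo 0 T)).prod ν)) :
    DiagonalRegular a b (fun τ t => ∫ x, |K (τ, x) - K (t, x)| ∂ν) := by
  have hA : MeasurableSet (Ioo 0 T ×ˢ (univ : Set ℝ)) := measurableSet_Ioo.prod .univ
  set K₁ := (Ioo 0 T ×ˢ univ).indicator K with hK₁
  have hK₁L : Integrable K₁ (volume.prod ν) := by
    rwa [hK₁, integrable_indicator_iff hA, IntegrableOn, ← Measure.restrict_prod_eq_prod_univ]
  have hi : ∀ θ, Integrable (fun z : ℝ × ℝ => |K₁ (z.1 - θ, z.2) - K₁ z|) (volume.prod ν) :=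
    fun θ => (((measurePreserving_fstShift ν θ).integrable_comp_of_integrable hK₁L).sub hK₁L).abs
  have hle : (volume.restrict (Ioo a b)).prod ν ≤ volume.prod ν :=
    Measure.prod_mono Measure.restrict_le_self le_rfl
  have hcont := continuous_integral_abs_shift_sub hK₁L hK₁L
  obtain ⟨C, hC⟩ := isCompact_Icc.exists_bound_of_continuousOn
    (hcont.continuousOn (s := Icc 0 a))
  have hmono : ∀ θ, (∫ z, |K₁ (z.1 - θ, z.2) - K₁ z| ∂((volume.restrict (Ioo a b)).prod ν)) ≤
      ∫ z, |K₁ (z.1 - θ, z.2) - K₁ z| ∂(volume.prod ν) := fun θ =>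
    integral_mono_measure hle (ae_of_all _ fun z => abs_nonneg _) (hi θ)
  have hK₁m : Measurable K₁ := hKm.indicator hA
  refine of_integrand (C := C) (H := fun θ z => |K₁ (z.1 - θ, z.2) - K₁ z|) ha
    ((hK₁m.comp (by fun_prop)).sub (hK₁m.comp (by fun_prop))).abs
    (fun θ _ => (hi θ).mono_measure hle) (fun θ hθ => ?_) ?_ fun θ hθ t ht => ?_
  · simp only [Real.norm_eq_abs, abs_abs]
    exact (hmono θ).trans ((le_abs_self _).trans (hC θ ⟨hθ.1, hθ.2.le⟩))
  · simp only [sub_zero, Prod.mk.eta, sub_self, abs_zero, integral_zero]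
    refine squeeze_zero (fun θ => integral_nonneg fun z => abs_nonneg _) hmono ?_
    simpa using (hcont.tendsto 0).mono_left (nhdsWithin_le_nhds (s := Ioi 0))
  · refine integral_congr_ae (ae_of_all _ fun x => ?_)
    simp only [hK₁]
    rw [indicator_of_mem (by exact ⟨⟨by linarith [ht.1, hθ.2], by linarith [ht.2, hθ.1]⟩, trivial⟩),
      indicator_of_mem (by exact ⟨⟨by linarith [ht.1], by linarith [ht.2]⟩, trivial⟩)]

end DiagonalRegular

lemma DiagonalRegular.exists_average_le {a b : ℝ} (ha : 0 < a) {Λ : ℝ → ℝ → ℝ}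
    (hΛ : DiagonalRegular a b Λ) {ε : ℝ} (hε : 0 < ε) :
    ∃ δ ∈ Ioc 0 a, ∀ h ∈ Ioo 0 δ,
      IntegrableOn (fun t => ∫ τ in Ioo (t - h) t, Λ τ t) (Ioo a b) ∧
      ∫ t in Ioo a b, ∫ τ in Ioo (t - h) t, Λ τ t ≤ h * ((∫ t in Ioo a b, Λ t t) + ε) := by
  obtain ⟨δ, hδ, hRδ⟩ := mem_nhdsGT_iff_exists_Ioo_subset.1 ((Metric.tendsto_nhds.1 hΛ.2.2) ε hε)
  refine ⟨min δ a, ⟨lt_min hδ ha, min_le_right _ _⟩, fun h hh => ?_⟩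
  have hh0 : 0 < h := hh.1
  obtain ⟨hhδ, hha⟩ := lt_min_iff.1 hh.2
  have hint : Integrable (fun q : ℝ × ℝ => Λ (q.2 - q.1) q.2)
      ((volume.restrict (Ioo 0 h)).prod (volume.restrict (Ioo a b))) :=
    hΛ.1.mono_measure (Measure.prod_mono (Measure.restrict_mono_set _
      (Ioo_subset_Ioo_right hha.le)) le_rfl)
  have hsub : ∀ t, (∫ τ in Ioo (t - h) t, Λ τ t) = ∫ θ in Ioo 0 h, Λ (t - θ) t := by
    intro t
    rw [← integral_Ioc_eq_integral_Ioo, ← integral_Ioc_eq_integral_Ioo,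
      ← intervalIntegral.integral_of_le (by linarith), ← intervalIntegral.integral_of_le hh0.le,
      intervalIntegral.integral_comp_sub_left (fun τ => Λ τ t), sub_zero]
  have hswap : (∫ t in Ioo a b, ∫ θ in Ioo 0 h, Λ (t - θ) t) =
      ∫ θ in Ioo 0 h, ∫ t in Ioo a b, Λ (t - θ) t :=
    (integral_integral_swap hint).symm
  have hup : (∫ θ in Ioo 0 h, ∫ t in Ioo a b, Λ (t - θ) t) ≤
      h * ((∫ t in Ioo a b, Λ t t) + ε) := by
    have : h * ((∫ t in Ioo a b, Λ t t) + ε) =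
        ∫ θ in Ioo 0 h, ((∫ t in Ioo a b, Λ t t) + ε) := by simp [hh0.le]
    rw [this]
    refine setIntegral_mono_on hint.integral_prod_left (integrable_const _) measurableSet_Ioo
      fun θ hθ => ?_
    have := hRδ (show θ ∈ Ioo 0 δ from ⟨hθ.1, hθ.2.trans hhδ⟩)
    simp only [mem_ofPred_eq, Real.dist_eq, abs_lt] at this
    linarith [this.2]
  simp_rw [hsub]
  exact ⟨hint.integral_prod_right, hswap.le.trans hup⟩

/-- Steklov averaging: a bound on the increments of `β` by the off-diagonal integrals of a
diagonally regular kernel passes to the diagonal. -/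
lemma DiagonalRegular.sub_le_integral_diag {a b : ℝ} (ha : 0 < a) (hab : a < b) {Λ : ℝ → ℝ → ℝ}
    (hΛ : DiagonalRegular a b Λ) {β : ℝ → ℝ} (hβ : ContinuousOn β (Icc 0 b))
    (H : ∀ᵐ t ∂(volume.restrict (Ioo a b)), ∀ h ∈ Ioo 0 a,
      β t - β (t - h) ≤ ∫ τ in Ioo (t - h) t, Λ τ t) :
    β b - β a ≤ ∫ t in Ioo a b, Λ t t := by
  have hβi : ∀ c d, 0 ≤ c → c ≤ d → d ≤ b → IntervalIntegrable β volume c d := by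
    intro c d h1 h2 h3
    refine ContinuousOn.intervalIntegrable ?_
    rw [uIcc_of_le h2]
    exact hβ.mono (Icc_subset_Icc h1 h3)
  refine le_of_forall_pos_le_add fun ε hε => ?_
  have hε3 : 0 < ε / 3 := by positivity
  obtain ⟨δ, hδ, hRδ⟩ := hΛ.exists_average_le ha hε3
  have hcb := Metric.continuousWithinAt_iff.1 (hβ b ⟨(ha.trans hab).le, le_rfl⟩) (ε / 3) hε3
  have hca := Metric.continuousWithinAt_iff.1 (hβ a ⟨ha.le, hab.le⟩) (ε / 3) hε3
  obtain ⟨δb, hδb, hcb⟩ := hcb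
  obtain ⟨δa, hδa, hca⟩ := hca
  obtain ⟨h, hh0, hh⟩ : ∃ h, 0 < h ∧ h < min (min δ a) (min (min δa δb) (b - a)) :=
    exists_between (by simp [hδ.1, ha, hδa, hδb, hab])
  simp only [lt_min_iff] at hh
  obtain ⟨⟨hhδ, hha⟩, ⟨hhδa, hhδb⟩, hhab⟩ := hh
  -- the integrated increment
  have hL : (∫ t in Ioo a b, (β t - β (t - h))) =
      (∫ t in (b - h)..b, β t) - ∫ t in (a - h)..a, β t := by
    rw [← integral_Ioc_eq_integral_Ioo, ← intervalIntegral.integral_of_le hab.le,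
      intervalIntegral.integral_sub (hβi a b ha.le hab.le le_rfl),
      intervalIntegral.integral_comp_sub_right]
    · rw [← intervalIntegral.integral_add_adjacent_intervals
        (hβi a (b - h) ha.le (by linarith) (by linarith))
        (hβi (b - h) b (by linarith) (by linarith) le_rfl),
        ← intervalIntegral.integral_add_adjacent_intervals
        (hβi (a - h) a (by linarith) (by linarith) (by linarith))
        (hβi a (b - h) ha.le (by linarith) (by linarith))]
      ring
    · refine ContinuousOn.intervalIntegrable ?_
      rw [uIcc_of_le hab.le]
      refine hβ.comp (by fun_prop) fun t ht => ⟨by linarith [ht.1], by linarith [ht.2]⟩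
  have hLb : h * (β b - ε / 3) ≤ ∫ t in (b - h)..b, β t := by
    have : h * (β b - ε / 3) = ∫ t in (b - h)..b, (β b - ε / 3) := by
      rw [intervalIntegral.integral_const, sub_sub_cancel, smul_eq_mul]
    rw [this]
    refine intervalIntegral.integral_mono_on (by linarith) (by simp)
      (hβi _ _ (by linarith) (by linarith) le_rfl) fun t ht => ?_
    have := hcb (x := t) ⟨by linarith [ht.1], ht.2⟩ (by
      rw [Real.dist_eq, abs_lt]; constructor <;> linarith [ht.1, ht.2])
    rw [Real.dist_eq, abs_lt] at this
    linarith [this.1]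
  have hLa : (∫ t in (a - h)..a, β t) ≤ h * (β a + ε / 3) := by
    have : h * (β a + ε / 3) = ∫ t in (a - h)..a, (β a + ε / 3) := by
      rw [intervalIntegral.integral_const, sub_sub_cancel, smul_eq_mul]
    rw [this]
    refine intervalIntegral.integral_mono_on (by linarith)
      (hβi _ _ (by linarith) (by linarith) hab.le) (by simp) fun t ht => ?_
    have := hca (x := t) ⟨by linarith [ht.1], by linarith [ht.2]⟩ (by
      rw [Real.dist_eq, abs_lt]; constructor <;> linarith [ht.1, ht.2])
    rw [Real.dist_eq, abs_lt] at this
    linarith [this.2]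
  obtain ⟨hint, hup⟩ := hRδ h ⟨hh0, hhδ⟩
  have hle : (∫ t in Ioo a b, (β t - β (t - h))) ≤ ∫ t in Ioo a b, ∫ τ in Ioo (t - h) t, Λ τ t := by
    refine integral_mono_ae ?_ hint ?_
    · refine ContinuousOn.integrableOn_Icc ?_ |>.mono_set Ioo_subset_Icc_self
      refine (hβ.mono (Icc_subset_Icc_left ha.le)).sub ?_
      refine hβ.comp (by fun_prop) fun t ht => ⟨by linarith [ht.1], by linarith [ht.2]⟩
    · filter_upwards [H] with t ht
      exact ht h ⟨hh0, hha⟩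
  have : h * (β b - β a) ≤ h * ((∫ t in Ioo a b, Λ t t) + ε) := by
    rw [hL] at hle
    nlinarith
  exact le_of_mul_le_mul_left this hh0

lemma continuous_integral_zero_to {Φ : ℝ → ℝ → ℝ} (hΦ : Continuous (Function.uncurry Φ)) :
    Continuous fun q : ℝ × ℝ => ∫ s in (0:ℝ)..q.2, Φ q.1 s := by
  refine intervalIntegral.continuous_parametric_intervalIntegral_of_continuous (μ := volume)
    (f := fun (q : ℝ × ℝ) s => Φ q.1 s) ?_ continuous_snd
  exact hΦ.comp (g := Function.uncurry Φ) (f := fun w : (ℝ × ℝ) × ℝ => (w.1.1, w.2)) (by fun_prop)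

lemma hasDerivAt_double_integral {Φ : ℝ → ℝ → ℝ} (hΦ : Continuous (Function.uncurry Φ))
    (c d t : ℝ) :
    HasDerivAt (fun t => ∫ τ in (0:ℝ)..(t - c), ∫ s in (0:ℝ)..(t - d), Φ τ s)
      ((∫ s in (0:ℝ)..(t - d), Φ (t - c) s) + ∫ τ in (0:ℝ)..(t - c), Φ τ (t - d)) t := by
  have hΦ' : Continuous (Function.uncurry (fun s τ => Φ τ s)) := hΦ.comp continuous_swap
  have h1 := continuous_integral_zero_to hΦ
  have h2 : Continuous fun q : ℝ × ℝ => ∫ τ in (0:ℝ)..q.1, Φ τ q.2 :=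
    (continuous_integral_zero_to hΦ').comp continuous_swap
  have hswap : ∀ x y, (∫ τ in (0:ℝ)..x, ∫ s in (0:ℝ)..y, Φ τ s) =
      ∫ s in (0:ℝ)..y, ∫ τ in (0:ℝ)..x, Φ τ s := fun x y => by
    refine intervalIntegral_intervalIntegral_swap ?_
    exact (hΦ.continuousOn.integrableOn_compact
      (isCompact_uIcc.prod isCompact_uIcc)).mono_set
      (prod_mono uIoc_subset_uIcc uIoc_subset_uIcc)
  have key := hasStrictFDerivAt_uncurry_coprod (𝕜 := ℝ) (u := (t - c, t - d))
    (f := fun x y => ∫ τ in (0:ℝ)..x, ∫ s in (0:ℝ)..y, Φ τ s)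
    (f₁ := fun x y => ContinuousLinearMap.toSpanSingleton ℝ (∫ s in (0:ℝ)..y, Φ x s))
    (f₂ := fun x y => ContinuousLinearMap.toSpanSingleton ℝ (∫ τ in (0:ℝ)..x, Φ τ y))
    (Eventually.of_forall fun q => ?_) (Eventually.of_forall fun q => ?_) ?_ ?_
  · have := key.hasFDerivAt.comp_hasDerivAt t
      (f := fun t : ℝ => (t - c, t - d))
      (((hasDerivAt_id t).sub_const c).prodMk ((hasDerivAt_id t).sub_const d))
    simpa [Function.comp_def, Function.HasUncurry.uncurry] using this
  · have : Continuous fun x => ∫ s in (0:ℝ)..q.2, Φ x s := h1.comp (f := fun x : ℝ => (x, q.2)) (by fun_prop)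
    exact (this.integral_hasStrictDerivAt 0 q.1).hasDerivAt.hasFDerivAt
  · simp_rw [hswap]
    have : Continuous fun y => ∫ τ in (0:ℝ)..q.1, Φ τ y := h2.comp (f := fun y : ℝ => (q.1, y)) (by fun_prop)
    exact (this.integral_hasStrictDerivAt 0 q.2).hasDerivAt.hasFDerivAt
  · exact ((ContinuousLinearMap.toSpanSingletonCLE).continuous.comp h1).continuousAt
  · exact ((ContinuousLinearMap.toSpanSingletonCLE).continuous.comp h2).continuousAt

lemma abs_double_integral_sub_le {Φ : ℝ → ℝ → ℝ} (hΦ : Continuous (Function.uncurry Φ)) (t : ℝ)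
    {ε : ℝ} (hε : 0 < ε) : ∃ δ > 0, ∀ h ∈ Ioo 0 δ,
      |(∫ τ in (t - h)..t, ∫ s in (t - h)..t, Φ τ s) - h * (h * Φ t t)| ≤ h * (h * ε) := by
  obtain ⟨δ, hδ, hb⟩ := Metric.continuousAt_iff.1 (hΦ.continuousAt (x := (t, t))) ε hε
  refine ⟨δ, hδ, fun h hh => ?_⟩
  have hc : ∀ τ, Continuous (Φ τ) := fun τ => hΦ.comp (f := fun s : ℝ => (τ, s)) (by fun_prop)
  have hc2 : Continuous fun τ => ∫ s in (t - h)..t, Φ τ s :=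
    intervalIntegral.continuous_parametric_intervalIntegral_of_continuous' hΦ _ _
  have h0 : h * (h * Φ t t) = ∫ τ in (t - h)..t, ∫ s in (t - h)..t, Φ t t := by
    simp
  rw [h0, ← intervalIntegral.integral_sub (hc2.intervalIntegrable _ _) (by simp)]
  have hu : ∀ τ ∈ uIoc (t - h) t, |τ - t| < δ := by
    intro τ hτ
    rw [uIoc_of_le (by linarith [hh.1])] at hτ
    rw [abs_lt]
    constructor <;> linarith [hτ.1, hτ.2, hh.1, hh.2]
  have key := intervalIntegral.norm_integral_le_of_norm_le_const (a := t - h) (b := t)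
    (C := h * ε) (f := fun τ => (∫ s in (t - h)..t, Φ τ s) - ∫ s in (t - h)..t, Φ t t)
    fun τ hτ => ?_
  · rw [sub_sub_cancel, abs_of_pos hh.1, mul_comm] at key
    exact key
  · rw [← intervalIntegral.integral_sub ((hc τ).intervalIntegrable _ _) (by simp)]
    have k2 := intervalIntegral.norm_integral_le_of_norm_le_const (a := t - h) (b := t)
      (C := ε) (f := fun s => Φ τ s - Φ t t) fun s hs => ?_
    · rwa [sub_sub_cancel, abs_of_pos hh.1, mul_comm] at k2
    · have : dist (τ, s) (t, t) < δ := by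
        rw [Prod.dist_eq]
        exact max_lt (hu τ hτ) (hu s hs)
      exact (hb this).le

/-- A distributional bound `(∂ₜ + ∂ₛ) Φ ≤ Λ` on squares centred on the diagonal yields a bound for
the increment of `Φ` along the diagonal. -/
lemma DiagonalRegular.diag_sub_le {a b : ℝ} (ha : 0 < a) (hab : a < b) {Φ Λ : ℝ → ℝ → ℝ}
    (hΦ : Continuous (Function.uncurry Φ)) (hΛ : DiagonalRegular a b Λ)
    (H : ∀ h ∈ Ioo 0 a, ∀ᵐ t ∂(volume.restrict (Ioo a b)),
      (∫ s in (t - h)..t, (Φ t s - Φ (t - h) s)) + (∫ τ in (t - h)..t, (Φ τ t - Φ τ (t - h)))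
        ≤ h * ∫ τ in Ioo (t - h) t, Λ τ t) :
    Φ b b - Φ a a ≤ ∫ t in Ioo a b, Λ t t := by
  refine le_of_forall_pos_le_add fun ε hε => ?_
  have hε3 : 0 < ε / 3 := by positivity
  obtain ⟨δ, hδ, hRδ⟩ := hΛ.exists_average_le ha hε3
  obtain ⟨δa, hδa, hca⟩ := abs_double_integral_sub_le hΦ a hε3
  obtain ⟨δb, hδb, hcb⟩ := abs_double_integral_sub_le hΦ b hε3
  obtain ⟨h, hh0, hh⟩ : ∃ h, 0 < h ∧ h < min δ (min δa δb) :=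
    exists_between (by simp [hδ.1, hδa, hδb])
  simp only [lt_min_iff] at hh
  obtain ⟨hhδ, hhδa, hhδb⟩ := hh
  have hc1 : ∀ τ, Continuous (Φ τ) := fun τ => hΦ.comp (f := fun s : ℝ => (τ, s)) (by fun_prop)
  have hc2 : ∀ s, Continuous (fun τ => Φ τ s) := fun s =>
    hΦ.comp (f := fun τ : ℝ => (τ, s)) (by fun_prop)
  have hI := continuous_integral_zero_to hΦ
  have hΦ' : Continuous (Function.uncurry (fun s τ => Φ τ s)) := hΦ.comp continuous_swap
  have hI' : Continuous fun q : ℝ × ℝ => ∫ τ in (0:ℝ)..q.1, Φ τ q.2 :=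
    (continuous_integral_zero_to hΦ').comp continuous_swap
  set M : ℝ → ℝ := fun t => ∫ τ in (t - h)..t, ∫ s in (t - h)..t, Φ τ s with hM
  set M' : ℝ → ℝ := fun t => (∫ s in (t - h)..t, (Φ t s - Φ (t - h) s)) +
    ∫ τ in (t - h)..t, (Φ τ t - Φ τ (t - h)) with hM'
  have hMe : M = fun t => (∫ τ in (0:ℝ)..t, ∫ s in (0:ℝ)..t, Φ τ s)
      - (∫ τ in (0:ℝ)..(t - h), ∫ s in (0:ℝ)..t, Φ τ s)
      - (∫ τ in (0:ℝ)..t, ∫ s in (0:ℝ)..(t - h), Φ τ s)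
      + ∫ τ in (0:ℝ)..(t - h), ∫ s in (0:ℝ)..(t - h), Φ τ s := by
    ext t
    simp only [hM]
    have e1 : ∀ τ, (∫ s in (t - h)..t, Φ τ s) =
        (∫ s in (0:ℝ)..t, Φ τ s) - ∫ s in (0:ℝ)..(t - h), Φ τ s := fun τ =>
      (intervalIntegral.integral_interval_sub_left ((hc1 τ).intervalIntegrable _ _)
        ((hc1 τ).intervalIntegrable _ _)).symm
    have k1 : ∀ y, Continuous fun τ => ∫ s in (0:ℝ)..y, Φ τ s := fun y =>
      hI.comp (f := fun τ : ℝ => (τ, y)) (by fun_prop)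
    simp_rw [e1]
    rw [intervalIntegral.integral_sub ((k1 _).intervalIntegrable _ _)
      ((k1 _).intervalIntegrable _ _),
      ← intervalIntegral.integral_interval_sub_left ((k1 t).intervalIntegrable 0 t)
        ((k1 t).intervalIntegrable 0 (t - h)),
      ← intervalIntegral.integral_interval_sub_left ((k1 (t - h)).intervalIntegrable 0 t)
        ((k1 (t - h)).intervalIntegrable 0 (t - h))]
    ring
  have hM'e : M' = fun t => ((∫ s in (0:ℝ)..t, Φ t s) - ∫ s in (0:ℝ)..(t - h), Φ t s)
      - ((∫ s in (0:ℝ)..t, Φ (t - h) s) - ∫ s in (0:ℝ)..(t - h), Φ (t - h) s)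
      + (((∫ τ in (0:ℝ)..t, Φ τ t) - ∫ τ in (0:ℝ)..(t - h), Φ τ t)
      - ((∫ τ in (0:ℝ)..t, Φ τ (t - h)) - ∫ τ in (0:ℝ)..(t - h), Φ τ (t - h))) := by
    ext t
    simp only [hM']
    rw [intervalIntegral.integral_sub ((hc1 _).intervalIntegrable _ _)
      ((hc1 _).intervalIntegrable _ _), intervalIntegral.integral_sub
      ((hc2 _).intervalIntegrable _ _) ((hc2 _).intervalIntegrable _ _),
      ← intervalIntegral.integral_interval_sub_left ((hc1 t).intervalIntegrable 0 t)
        ((hc1 t).intervalIntegrable 0 (t - h)),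
      ← intervalIntegral.integral_interval_sub_left ((hc1 (t - h)).intervalIntegrable 0 t)
        ((hc1 (t - h)).intervalIntegrable 0 (t - h)),
      ← intervalIntegral.integral_interval_sub_left ((hc2 t).intervalIntegrable 0 t)
        ((hc2 t).intervalIntegrable 0 (t - h)),
      ← intervalIntegral.integral_interval_sub_left ((hc2 (t - h)).intervalIntegrable 0 t)
        ((hc2 (t - h)).intervalIntegrable 0 (t - h))]
  have hder : ∀ t, HasDerivAt M (M' t) t := by
    intro t
    have := (((hasDerivAt_double_integral hΦ 0 0 t).sub (hasDerivAt_double_integral hΦ h 0 t)).sub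
      (hasDerivAt_double_integral hΦ 0 h t)).add (hasDerivAt_double_integral hΦ h h t)
    simp only [sub_zero] at this
    rw [hMe, hM'e]
    refine HasDerivAt.congr_deriv this ?_
    ring
  have hM'c : Continuous M' := by
    rw [hM'e]
    have a1 : ∀ c d, Continuous fun t => (∫ s in (0:ℝ)..(t - d), Φ (t - c) s) := fun c d =>
      hI.comp (f := fun t : ℝ => (t - c, t - d)) (by fun_prop)
    have a2 : ∀ c d, Continuous fun t => (∫ τ in (0:ℝ)..(t - d), Φ τ (t - c)) := fun c d =>
      hI'.comp (f := fun t : ℝ => (t - d, t - c)) (by fun_prop)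
    have b1 := a1 0 0; have b2 := a1 0 h; have b3 := a1 h 0; have b4 := a1 h h
    have b5 := a2 0 0; have b6 := a2 0 h; have b7 := a2 h 0; have b8 := a2 h h
    simp only [sub_zero] at b1 b2 b3 b5 b6 b7
    exact ((b1.sub b2).sub (b3.sub b4)).add ((b5.sub b6).sub (b7.sub b8))
  have hFTC : M b - M a = ∫ t in Ioo a b, M' t := by
    rw [← integral_Ioc_eq_integral_Ioo, ← intervalIntegral.integral_of_le hab.le,
      intervalIntegral.integral_eq_sub_of_hasDerivAt (fun t _ => hder t)
        (hM'c.intervalIntegrable _ _)]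
  obtain ⟨hint, hup⟩ := hRδ h ⟨hh0, hhδ⟩
  have hle : (∫ t in Ioo a b, M' t) ≤ ∫ t in Ioo a b, h * ∫ τ in Ioo (t - h) t, Λ τ t :=
    integral_mono_ae (hM'c.integrableOn_Icc.mono_set Ioo_subset_Icc_self) (hint.const_mul h)
      (H h ⟨hh0, hhδ.trans_le hδ.2⟩)
  rw [integral_const_mul, ← hFTC] at hle
  have h1 := abs_le.1 (hca h ⟨hh0, hhδa⟩)
  have h2 := abs_le.1 (hcb h ⟨hh0, hhδb⟩)
  have h3 := mul_le_mul_of_nonneg_left hup hh0.le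
  have : h * (h * (Φ b b - Φ a a)) ≤ h * (h * ((∫ t in Ioo a b, Λ t t) + ε)) := by
    have e3 : h * (h * ε) = 3 * (h * (h * (ε / 3))) := by ring
    simp only [mul_add, mul_sub] at *
    linarith [h1.1, h2.2, h1.2, h2.1]
  exact le_of_mul_le_mul_left (le_of_mul_le_mul_left this hh0) hh0

/-- Lebesgue measure on the open edge `(0, ℓ_e)`. -/
noncomputable abbrev MetricGraph.edgeMeasure (G : MetricGraph) (e : G.E) : Measure ℝ :=
  volume.restrict (Ioo 0 (G.len e))

/-- The weak form of `(ρ_p(D))' + F` with vertex fluxes `W`, tested against `φ` with derivative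
`φ'` and vertex values `φV`. -/
noncomputable def weakForm (G : MetricGraph) (p : G.E → ℝ) (F D : G.E → ℝ → ℝ) (W : G.V → ℝ)
    (φ φ' : G.E → ℝ → ℝ) (φV : G.V → ℝ) : ℝ :=
  ∑ e, ((∫ x, F e x * φ e x ∂G.edgeMeasure e) - ∫ x, rho (p e) (D e x) * φ' e x ∂G.edgeMeasure e)
    + ∑ z, W z * φV z

/-- A weak solution `v` on `[0, T]` in time-integrated form, with jointly measurable
representatives `U` of the solution, `D` of its space derivative, `Z` of its vertex values, `F` of
the source and `W` of the vertex fluxes. -/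
structure RegularSolution (G : MetricGraph) (p : G.E → ℝ) (γ : G.E → ℝ → ℝ) (T : ℝ)
    (v U D F : ℝ → G.E → ℝ → ℝ) (Z W : ℝ → G.V → ℝ) : Prop where
  measurable_U : ∀ e, Measurable fun q : ℝ × ℝ => U q.1 e q.2
  measurable_D : ∀ e, Measurable fun q : ℝ × ℝ => D q.1 e q.2
  measurable_F : ∀ e, Measurable fun q : ℝ × ℝ => F q.1 e q.2
  measurable_Z : ∀ z, Measurable fun t => Z t z
  measurable_W : ∀ z, Measurable fun t => W t z
  sobolev : ∀ᵐ t ∂(volume.restrict (Ioo 0 T)), GraphSobolev G p (U t) (D t) (Z t)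
  integrable_D : ∀ e, Integrable (fun q : ℝ × ℝ => |D q.1 e q.2| ^ p e)
    ((volume.restrict (Ioo 0 T)).prod (G.edgeMeasure e))
  integrable_F : ∀ e, Integrable (fun q : ℝ × ℝ => F q.1 e q.2)
    ((volume.restrict (Ioo 0 T)).prod (G.edgeMeasure e))
  integrable_W : ∀ z, IntegrableOn (fun t => W t z) (Ioo 0 T)
  integrable_v : ∀ t ∈ Icc 0 T, ∀ e, Integrable (v t e) (G.edgeMeasure e)
  tendsto_v : ∀ e, ∀ s ∈ Icc 0 T,
    Tendsto (fun t => ∫ x, |v t e x - v s e x| ∂G.edgeMeasure e) (𝓝[Icc 0 T] s) (𝓝 0)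
  v_eq : ∀ᵐ t ∂(volume.restrict (Ioo 0 T)), ∀ e, ∀ᵐ x ∂G.edgeMeasure e, v t e x = γ e (U t e x)
  sub_eq : ∀ φ φ' φV, GraphSobolev G p φ φ' φV → ∀ a b, 0 < a → a < b → b < T →
    ∑ e, ∫ x, (v b e x - v a e x) * φ e x ∂G.edgeMeasure e =
      ∫ t in Ioo a b, weakForm G p (F t) (D t) (W t) φ φ' φV

lemma abs_rho {p r : ℝ} (hp : 1 < p) : |rho p r| = |r| ^ (p - 1) := by
  unfold rho
  rcases eq_or_ne r 0 with rfl | hr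
  · simp [Real.zero_rpow (by linarith : p - 1 ≠ 0)]
  · rw [abs_mul, abs_of_nonneg (by positivity), ← Real.rpow_add_one (abs_ne_zero.2 hr)]
    congr 1
    ring

lemma measurable_rho (p : ℝ) : Measurable (rho p) := by
  unfold rho
  fun_prop

lemma rho_monotone {p : ℝ} (hp : 1 < p) : Monotone (rho p) := by
  have hodd : ∀ r, rho p (-r) = - rho p r := fun r => by simp [rho]
  have hpos : ∀ r, 0 ≤ r → rho p r = r ^ (p - 1) := fun r hr => by
    have := abs_rho (r := r) hp
    rwa [abs_of_nonneg (by unfold rho; positivity), abs_of_nonneg hr] at this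
  have hmono : ∀ r s, 0 ≤ r → r ≤ s → rho p r ≤ rho p s := fun r s hr hrs => by
    rw [hpos r hr, hpos s (hr.trans hrs)]
    exact Real.rpow_le_rpow hr hrs (by linarith)
  have h0 : ∀ r, 0 ≤ r → 0 ≤ rho p r := fun r hr => by unfold rho; positivity
  intro r s hrs
  rcases le_total 0 r with hr | hr
  · exact hmono r s hr hrs
  rcases le_total 0 s with hs | hs
  · have := h0 (-r) (by linarith)
    rw [hodd] at this
    linarith [h0 s hs]
  · have := hmono (-s) (-r) (by linarith) (by linarith)
    rw [hodd, hodd] at this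
    linarith

lemma holderConjugate_ofReal {p : ℝ} (hp : 1 < p) :
    (ENNReal.ofReal (p / (p - 1))).HolderConjugate (ENNReal.ofReal p) :=
  (Real.HolderConjugate.conjExponent hp).symm.ennrealOfReal

lemma memLp_of_integrable_rpow {α : Type*} [MeasurableSpace α] {μ : Measure α} {p : ℝ}
    (hp : 0 < p) {f : α → ℝ} (hf : AEStronglyMeasurable f μ)
    (h : Integrable (fun x => |f x| ^ p) μ) : MemLp f (ENNReal.ofReal p) μ := by
  rw [← integrable_norm_rpow_iff hf (by simpa using hp) (by simp), ENNReal.toReal_ofReal hp.le]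
  exact h

lemma memLp_rho {α : Type*} [MeasurableSpace α] {μ : Measure α} {p : ℝ} (hp : 1 < p)
    {f : α → ℝ} (hf : Measurable f) (h : Integrable (fun x => |f x| ^ p) μ) :
    MemLp (fun x => rho p (f x)) (ENNReal.ofReal (p / (p - 1))) μ := by
  refine memLp_of_integrable_rpow (div_pos (by linarith) (by linarith))
    ((measurable_rho p).comp hf).aestronglyMeasurable ?_
  have : (fun x => |rho p (f x)| ^ (p / (p - 1))) = fun x => |f x| ^ p := by
    ext x
    rw [abs_rho hp, ← Real.rpow_mul (abs_nonneg _), mul_div_cancel₀]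
    linarith
  rwa [this]

lemma integrable_rho_mul {α : Type*} [MeasurableSpace α] {μ : Measure α} {p : ℝ} (hp : 1 < p)
    {f g : α → ℝ} (hf : Measurable f) (h : Integrable (fun x => |f x| ^ p) μ)
    (hg : MemLp g (ENNReal.ofReal p) μ) : Integrable (fun x => rho p (f x) * g x) μ := by
  have := holderConjugate_ofReal hp
  exact (memLp_rho hp hf h).integrable_mul hg

lemma memLp_top_of_abs_le {α : Type*} [MeasurableSpace α] {μ : Measure α} {f : α → ℝ}
    (hf : AEStronglyMeasurable f μ) {C : ℝ} (h : ∀ᵐ x ∂μ, |f x| ≤ C) : MemLp f ∞ μ :=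
  memLp_top_of_bound hf C h

lemma IntervalSobolev.memLp_top {ℓ p : ℝ} {u u' : ℝ → ℝ} (hℓ : 0 < ℓ)
    (h : IntervalSobolev ℓ p u u') : MemLp u ∞ (volume.restrict (Ioo 0 ℓ)) := by
  obtain ⟨C, hC⟩ := h.exists_bound hℓ
  refine memLp_top_of_bound (((h.continuousOn hℓ).mono
    Ioo_subset_Icc_self).aestronglyMeasurable measurableSet_Ioo) C ?_
  exact (ae_restrict_mem measurableSet_Ioo).mono fun x hx => hC x (Ioo_subset_Icc_self hx)

section
variable {G : MetricGraph} {p : G.E → ℝ} {T : ℝ} {D F : ℝ → G.E → ℝ → ℝ} {W : ℝ → G.V → ℝ}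
  {φ φ' : G.E → ℝ → ℝ} {φV : G.V → ℝ}

lemma integrable_source_pairing {e : G.E}
    (hF : Integrable (fun q : ℝ × ℝ => F q.1 e q.2)
      ((volume.restrict (Ioo 0 T)).prod (G.edgeMeasure e)))
    (hφ : GraphSobolev G p φ φ' φV) :
    Integrable (fun q : ℝ × ℝ => F q.1 e q.2 * φ e q.2)
      ((volume.restrict (Ioo 0 T)).prod (G.edgeMeasure e)) :=
  (memLp_one_iff_integrable.2 hF).integrable_mul
    (((hφ.1 e).memLp_top (G.len_pos e)).comp_snd (volume.restrict (Ioo 0 T)))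

lemma integrable_flux_pairing (hp : ∀ e, 1 < p e) {e : G.E}
    (hDm : Measurable fun q : ℝ × ℝ => D q.1 e q.2)
    (hD : Integrable (fun q : ℝ × ℝ => |D q.1 e q.2| ^ p e)
      ((volume.restrict (Ioo 0 T)).prod (G.edgeMeasure e)))
    (hφ : GraphSobolev G p φ φ' φV) :
    Integrable (fun q : ℝ × ℝ => rho (p e) (D q.1 e q.2) * φ' e q.2)
      ((volume.restrict (Ioo 0 T)).prod (G.edgeMeasure e)) :=
  integrable_rho_mul (hp e) hDm hD
    (((hφ.1 e).memLp (by linarith [hp e])).comp_snd (volume.restrict (Ioo 0 T)))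

end

lemma MetricGraph.exists_incident (G : MetricGraph) [Nonempty G.E] (z : G.V) :
    ∃ e, G.ι e = z ∨ G.τ e = z := by
  obtain ⟨e₀⟩ := ‹Nonempty G.E›
  rcases Relation.ReflTransGen.cases_head (G.connected z (G.ι e₀)) with h | ⟨c, ⟨e, he⟩, -⟩
  · exact ⟨e₀, Or.inl h.symm⟩
  · rcases he with he | he
    · exact ⟨e, Or.inl he.1⟩
    · exact ⟨e, Or.inr he.2⟩

theorem IsEvolWeakSolution.exists_regularSolution {G : MetricGraph} [Nonempty G.E]
    {p : G.E → ℝ} (hp : ∀ e, 1 < p e)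
    {γ : G.E → ℝ → ℝ} {f : ℝ → G.E → ℝ → ℝ} {ω : ℝ → G.V → ℝ} {v₀ : G.E → ℝ → ℝ} {T : ℝ}
    {v : ℝ → G.E → ℝ → ℝ} (h : IsEvolWeakSolution G p γ f ω v₀ T v)
    (hf : ∀ e, Integrable (fun q : ℝ × ℝ => f q.1 e q.2)
      ((volume.restrict (Ioo 0 T)).prod (G.edgeMeasure e)))
    (hω : ∀ z, IntegrableOn (fun t => ω t z) (Ioo 0 T)) :
    ∃ U D F Z W, RegularSolution G p γ T v U D F Z W ∧
      (∀ e, ∀ᵐ t ∂(volume.restrict (Ioo 0 T)), ∀ᵐ x ∂G.edgeMeasure e, F t e x = f t e x) ∧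
      ∀ z, ∀ᵐ t ∂(volume.restrict (Ioo 0 T)), W t z = ω t z := by
  obtain ⟨hvi, hvc, -, u, u', uV, hum, hsob, -, hu'i, hvu, hweak⟩ := h
  have hUD : ∀ e, ∃ U D : ℝ → ℝ → ℝ, Measurable (Function.uncurry U) ∧
      Measurable (Function.uncurry D) ∧ ∀ᵐ t ∂(volume.restrict (Ioo 0 T)),
        (∀ x ∈ Icc 0 (G.len e), U t x = u t e x) ∧
        ∀ᵐ x ∂G.edgeMeasure e, D t x = u' t e x := fun e =>
    exists_measurable_version (u := fun t x => u t e x) (u' := fun t x => u' t e x)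
      (G.len_pos e) (hum e) (hsob.mono fun t ht => ht.1 e)
  choose U D hUm hDm hUD using hUD
  have hUDa := eventually_all.2 hUD
  have hZ : ∀ z, ∃ Z : ℝ → ℝ, Measurable Z ∧ ∀ᵐ t ∂(volume.restrict (Ioo 0 T)), Z t = uV t z := by
    intro z
    obtain ⟨e, rfl | rfl⟩ := G.exists_incident z
    · refine ⟨fun t => U e t 0, (hUm e).comp (measurable_id.prodMk measurable_const), ?_⟩
      filter_upwards [hUD e, hsob] with t h1 h2
      rw [h1.1 0 (left_mem_Icc.2 (G.len_pos e).le), h2.2.1]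
    · refine ⟨fun t => U e t (G.len e), (hUm e).comp (measurable_id.prodMk measurable_const), ?_⟩
      filter_upwards [hUD e, hsob] with t h1 h2
      rw [h1.1 _ (right_mem_Icc.2 (G.len_pos e).le), h2.2.2]
  choose Z hZm hZ using hZ
  have hZa := eventually_all.2 hZ
  let F : ℝ → G.E → ℝ → ℝ := fun t e x => (hf e).aestronglyMeasurable.mk _ (t, x)
  have hFm : ∀ e, Measurable fun q : ℝ × ℝ => F q.1 e q.2 := fun e =>
    (hf e).aestronglyMeasurable.stronglyMeasurable_mk.measurable
  have hFf : ∀ e, (fun q : ℝ × ℝ => f q.1 e q.2)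
      =ᵐ[(volume.restrict (Ioo 0 T)).prod (G.edgeMeasure e)] fun q : ℝ × ℝ => F q.1 e q.2 :=
    fun e => (hf e).aestronglyMeasurable.ae_eq_mk
  have hFi := fun e => (hf e).congr (hFf e)
  have hFf' : ∀ e, ∀ᵐ t ∂(volume.restrict (Ioo 0 T)), ∀ᵐ x ∂G.edgeMeasure e,
      F t e x = f t e x := fun e => Measure.ae_ae_of_ae_prod ((hFf e).mono fun q hq => hq.symm)
  let W : ℝ → G.V → ℝ := fun t z => (hω z).aestronglyMeasurable.mk _ t
  have hWm : ∀ z, Measurable fun t => W t z := fun z =>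
    (hω z).aestronglyMeasurable.stronglyMeasurable_mk.measurable
  have hWω : ∀ z, ∀ᵐ t ∂(volume.restrict (Ioo 0 T)), W t z = ω t z := fun z =>
    (hω z).aestronglyMeasurable.ae_eq_mk.symm
  have hWi : ∀ z, IntegrableOn (fun t => W t z) (Ioo 0 T) := fun z =>
    (hω z).congr (hω z).aestronglyMeasurable.ae_eq_mk
  have hFfa := eventually_all.2 hFf'
  have hWa := eventually_all.2 hWω
  have hDi : ∀ e, Integrable (fun q : ℝ × ℝ => |D e q.1 q.2| ^ p e)
      ((volume.restrict (Ioo 0 T)).prod (G.edgeMeasure e)) := by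
    intro e
    have hm : Measurable fun q : ℝ × ℝ => |D e q.1 q.2| ^ p e := (hDm e).abs.pow_const _
    have hi := hu'i e
    rw [IntegrableOn, Measure.volume_eq_prod, ← Measure.prod_restrict] at hi
    rw [integrable_prod_iff hm.aestronglyMeasurable]
    refine ⟨?_, hi.norm.integral_prod_left.congr ?_⟩
    · filter_upwards [hUD e, hsob] with t h1 h2
      refine Integrable.congr (h2.1 e).2.1 ?_
      filter_upwards [h1.2] with x hx
      rw [hx]
    · filter_upwards [hUD e] with t h1
      refine integral_congr_ae ?_
      filter_upwards [h1.2] with x hx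
      rw [hx]
  have hvce : ∀ e, ∀ s ∈ Icc 0 T, Tendsto (fun t => ∫ x, |v t e x - v s e x| ∂G.edgeMeasure e)
      (𝓝[Icc 0 T] s) (𝓝 0) := by
    intro e s hs
    refine squeeze_zero (fun t => integral_nonneg fun x => abs_nonneg _) (fun t => ?_) (hvc s hs)
    exact Finset.single_le_sum (f := fun e => ∫ x, |v t e x - v s e x| ∂G.edgeMeasure e)
      (fun e _ => integral_nonneg fun x => abs_nonneg _) (Finset.mem_univ e)
  refine ⟨fun t e x => U e t x, fun t e x => D e t x, F, fun t z => Z z t, W,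
    ⟨hUm, hDm, hFm, hZm, hWm, ?_, hDi, hFi, hWi, hvi, hvce, ?_, ?_⟩, hFf', hWω⟩
  · filter_upwards [hUDa, hsob, hZa] with t h1 h2 h3
    refine ⟨fun e => (h2.1 e).congr (G.len_pos e) (h1 e).1 (h1 e).2, fun e => ?_, fun e => ?_⟩
    · beta_reduce
      rw [(h1 e).1 0 (left_mem_Icc.2 (G.len_pos e).le), h3, h2.2.1]
    · beta_reduce
      rw [(h1 e).1 _ (right_mem_Icc.2 (G.len_pos e).le), h3, h2.2.2]
  · filter_upwards [hUDa, ae_restrict_mem measurableSet_Ioo] with t h1 ht e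
    filter_upwards [hvu t (Ioo_subset_Icc_self ht) e, ae_restrict_mem measurableSet_Ioo] with x hx hxm
    rw [hx, (h1 e).1 x (Ioo_subset_Icc_self hxm)]
  intro φ φ' φV hφ a b ha hab hb
  have hvφ : ∀ t ∈ Icc 0 T, ∀ e, Integrable (fun x => v t e x * φ e x) (G.edgeMeasure e) :=
    fun t ht e => (memLp_one_iff_integrable.2 (hvi t ht e)).integrable_mul
      ((hφ.1 e).memLp_top (G.len_pos e))
  set m : ℝ → ℝ := fun t => ∑ e, ∫ x, v t e x * φ e x ∂G.edgeMeasure e with hm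
  have hmc : ContinuousOn m (Icc 0 T) := by
    refine continuousOn_finsetSum _ fun e _ s hs => ?_
    obtain ⟨C, hC⟩ := (hφ.1 e).exists_bound (G.len_pos e)
    have hlim := (hvce e s hs).mul_const C
    rw [zero_mul] at hlim
    refine tendsto_iff_dist_tendsto_zero.2 (squeeze_zero' (Eventually.of_forall fun _ => dist_nonneg) ?_ hlim)
    filter_upwards [self_mem_nhdsWithin] with t ht
    rw [Real.dist_eq, ← integral_sub (hvφ t ht e) (hvφ s hs e), ← integral_mul_const]
    refine (abs_integral_le_integral_abs).trans (integral_mono_ae ?_ ?_ ?_)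
    · exact ((hvφ t ht e).sub (hvφ s hs e)).abs
    · exact ((hvi t ht e).sub (hvi s hs e)).abs.mul_const C
    · filter_upwards [ae_restrict_mem measurableSet_Ioo] with x hx
      rw [← sub_mul, abs_mul]
      exact mul_le_mul_of_nonneg_left (hC x (Ioo_subset_Icc_self hx)) (abs_nonneg _)
  set A : ℝ → ℝ := fun t => ∑ e, ∫ x, rho (p e) (D e t x) * φ' e x ∂G.edgeMeasure e with hA
  set B : ℝ → ℝ := fun t => ∑ e, ∫ x, F t e x * φ e x ∂G.edgeMeasure e with hB
  set C : ℝ → ℝ := fun t => ∑ z, W t z * φV z with hC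
  have hAi : IntegrableOn A (Ioo 0 T) := integrable_finsetSum _ fun e _ =>
    (integrable_flux_pairing (D := fun t e x => D e t x) hp (hDm e) (hDi e) hφ).integral_prod_left
  have hBi : IntegrableOn B (Ioo 0 T) := integrable_finsetSum _ fun e _ =>
    (integrable_source_pairing (hFi e) hφ).integral_prod_left
  have hCi : IntegrableOn C (Ioo 0 T) := integrable_finsetSum _ fun z _ => (hWi z).mul_const _
  have hL : ∀ t, weakForm G p (F t) (fun e x => D e t x) (W t) φ φ' φV = B t - A t + C t :=
    fun t => by simp [weakForm, hA, hB, hC, Finset.sum_sub_distrib]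
  have key := sub_eq_integral_of_weak_deriv hmc ((hBi.sub hAi).add hCi) (fun ξ hξ hξ0 => ?_) ha hab hb
  · have hb' : b ∈ Icc 0 T := ⟨by linarith, hb.le⟩
    have ha' : a ∈ Icc 0 T := ⟨ha.le, by linarith⟩
    simp_rw [hL]
    refine Eq.trans ?_ key
    rw [hm, ← Finset.sum_sub_distrib]
    refine Finset.sum_congr rfl fun e _ => ?_
    rw [← integral_sub (hvφ b hb' e) (hvφ a ha' e)]
    simp_rw [sub_mul]
  · have hw := hweak φ φ' φV hφ ξ hξ hξ0
    have hξi : ∀ {g : ℝ → ℝ}, IntegrableOn g (Ioo 0 T) →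
        IntegrableOn (fun t => ξ t * g t) (Ioo 0 T) := by
      intro g hg
      obtain ⟨K, hK⟩ := isCompact_Icc.exists_bound_of_continuousOn
        (hξ.continuous.continuousOn (s := Icc 0 T))
      refine Integrable.bdd_mul (c := K) hg hξ.continuous.aestronglyMeasurable ?_
      exact (ae_restrict_mem measurableSet_Ioo).mono fun t ht => hK t (Ioo_subset_Icc_self ht)
    have eA : ∫ t in Ioo 0 T, ξ t * edgeSum G (fun e => ∫ x in Ioo (0:ℝ) (G.len e),
        rho (p e) (u' t e x) * φ' e x) = ∫ t in Ioo 0 T, ξ t * A t := by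
      refine integral_congr_ae ?_
      filter_upwards [hUDa] with t ht
      refine congrArg (ξ t * ·) (Finset.sum_congr rfl fun e _ => integral_congr_ae ?_)
      filter_upwards [(ht e).2] with x hx
      rw [hx]
    have eB : ∫ t in Ioo 0 T, ξ t * edgeSum G (fun e => ∫ x in Ioo (0:ℝ) (G.len e),
        f t e x * φ e x) = ∫ t in Ioo 0 T, ξ t * B t := by
      refine integral_congr_ae ?_
      filter_upwards [hFfa] with t ht
      refine congrArg (ξ t * ·) (Finset.sum_congr rfl fun e _ => integral_congr_ae ?_)
      filter_upwards [ht e] with x hx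
      rw [hx]
    have eC : ∫ t in Ioo 0 T, ξ t * vertexSum G (fun z => ω t z * φV z) =
        ∫ t in Ioo 0 T, ξ t * C t := by
      refine integral_congr_ae ?_
      filter_upwards [hWa] with t ht
      refine congrArg (ξ t * ·) (Finset.sum_congr rfl fun z _ => ?_)
      rw [ht z]
    rw [eA, eB, eC] at hw
    have e4 : ∫ t in Ioo 0 T, ξ t * (((B - A) + C) t) = (∫ t in Ioo 0 T, ξ t * B t) -
        (∫ t in Ioo 0 T, ξ t * A t) + ∫ t in Ioo 0 T, ξ t * C t := by
      rw [← integral_sub (hξi hBi) (hξi hAi)]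
      refine Eq.trans ?_ (integral_add ((hξi hBi).sub (hξi hAi)) (hξi hCi))
      refine integral_congr_ae (Eventually.of_forall fun t => ?_)
      simp only [Pi.add_apply, Pi.sub_apply]
      ring
    refine Eq.trans ?_ e4.symm
    have hw' : -(∫ t in Ioo 0 T, deriv ξ t * m t) + (∫ t in Ioo 0 T, ξ t * A t) =
      (∫ t in Ioo 0 T, ξ t * B t) + ∫ t in Ioo 0 T, ξ t * C t := hw
    linarith

/-- Bounded monotone `C¹` truncations. -/
structure SmoothStep (N : ℝ → ℝ) : Prop where
  contDiff : ContDiff ℝ 1 N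
  monotone : Monotone N
  abs_le_one : ∀ r, |N r| ≤ 1
  exists_abs_deriv_le : ∃ C, ∀ r, |deriv N r| ≤ C

/-- A smooth approximation of the indicator function of `(0, ∞)`. -/
noncomputable def posStep (n : ℕ) (r : ℝ) : ℝ := Real.smoothTransition (n * r)

/-- A smooth approximation of minus the indicator function of `(-∞, 0)`. -/
noncomputable def negStep (n : ℕ) (r : ℝ) : ℝ := -posStep n (-r)

lemma posStep_nonneg (n : ℕ) (r : ℝ) : 0 ≤ posStep n r := Real.smoothTransition.nonneg _

lemma posStep_le_one (n : ℕ) (r : ℝ) : posStep n r ≤ 1 := Real.smoothTransition.le_one _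

lemma smoothStep_posStep (n : ℕ) : SmoothStep (posStep n) where
  contDiff := Real.smoothTransition.contDiff.comp (contDiff_const.mul contDiff_id)
  monotone := fun r s h => Real.smoothTransition.monotone (by gcongr)
  abs_le_one := fun r => abs_le.2 ⟨by linarith [posStep_nonneg n r], posStep_le_one n r⟩
  exists_abs_deriv_le := by
    obtain ⟨C, hC⟩ := isCompact_Icc.exists_bound_of_continuousOn
      (continuous_deriv_smoothTransition.continuousOn (s := Icc 0 1))
    have hC' : ∀ r, |deriv Real.smoothTransition r| ≤ max C 0 := fun r => by
      by_cases hr : r ∈ Icc (0:ℝ) 1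
      · exact (hC r hr).trans (le_max_left _ _)
      · rw [deriv_smoothTransition_eq_zero (by rwa [mem_Icc, not_and_or, not_le, not_le] at hr)]
        simp
    refine ⟨n * max C 0, fun r => ?_⟩
    have : HasDerivAt (posStep n) (deriv Real.smoothTransition (n * r) * n) r := by
      have := (differentiable_smoothTransition (n * r)).hasDerivAt.comp r
        ((hasDerivAt_id r).const_mul (n:ℝ))
      rw [mul_one] at this
      exact this
    rw [this.deriv, abs_mul, Nat.abs_cast, mul_comm]
    gcongr
    exact hC' _

lemma deriv_negStep (n : ℕ) (r : ℝ) : deriv (negStep n) r = deriv (posStep n) (-r) := by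
  unfold negStep
  rw [deriv.fun_neg, deriv_comp_neg, neg_neg]

lemma smoothStep_negStep (n : ℕ) : SmoothStep (negStep n) where
  contDiff := ((smoothStep_posStep n).contDiff.comp contDiff_neg).neg
  monotone := fun r s h => neg_le_neg ((smoothStep_posStep n).monotone (neg_le_neg h))
  abs_le_one := fun r => by
    rw [negStep, abs_neg]
    exact (smoothStep_posStep n).abs_le_one _
  exists_abs_deriv_le := by
    obtain ⟨C, hC⟩ := (smoothStep_posStep n).exists_abs_deriv_le
    exact ⟨C, fun r => by rw [deriv_negStep]; exact hC _⟩

lemma deriv_posStep_nonneg (n : ℕ) (r : ℝ) : 0 ≤ deriv (posStep n) r :=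
  (smoothStep_posStep n).monotone.deriv_nonneg

lemma posStep_of_nonpos (n : ℕ) {r : ℝ} (hr : r ≤ 0) : posStep n r = 0 :=
  Real.smoothTransition.zero_of_nonpos (mul_nonpos_of_nonneg_of_nonpos n.cast_nonneg hr)

lemma tendsto_posStep {r : ℝ} (hr : 0 < r) : Tendsto (fun n => posStep n r) atTop (𝓝 1) := by
  obtain ⟨n₀, hn₀⟩ := exists_nat_gt (1 / r)
  refine tendsto_const_nhds.congr' ?_
  filter_upwards [eventually_ge_atTop n₀] with n hn
  have : (n₀:ℝ) ≤ n := by exact_mod_cast hn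
  rw [posStep, Real.smoothTransition.one_of_one_le]
  rw [div_lt_iff₀ hr] at hn₀
  nlinarith

/-- The entropy `∫_{γ(w)}^v N(g(y) - w) dy`, where `g` is the inverse of `γ`. -/
noncomputable def entropy (N γ g : ℝ → ℝ) (w v : ℝ) : ℝ := ∫ y in (γ w)..v, N (g y - w)

namespace entropy
variable {N γ g : ℝ → ℝ}

lemma continuous_integrand (hN : SmoothStep N) (hg : Continuous g) (w : ℝ) :
    Continuous fun y => N (g y - w) :=
  hN.contDiff.continuous.comp (hg.sub continuous_const)

protected lemma continuous (hN : SmoothStep N) (hγ : Continuous γ) (hg : Continuous g) :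
    Continuous fun q : ℝ × ℝ => entropy N γ g q.1 q.2 := by
  have h := continuous_integral_zero_to (Φ := fun w y => N (g y - w))
    (hN.contDiff.continuous.comp ((hg.comp continuous_snd).sub continuous_fst))
  have h1 : Continuous fun q : ℝ × ℝ => ∫ y in (0:ℝ)..γ q.1, N (g y - q.1) :=
    h.comp (continuous_fst.prodMk (hγ.comp continuous_fst))
  refine (h.sub h1).congr fun q => ?_
  exact intervalIntegral.integral_interval_sub_left
    ((continuous_integrand hN hg _).intervalIntegrable _ _)
    ((continuous_integrand hN hg _).intervalIntegrable _ _)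

lemma sub_eq (hN : SmoothStep N) (hg : Continuous g) (w v v' : ℝ) :
    entropy N γ g w v - entropy N γ g w v' = ∫ y in v'..v, N (g y - w) :=
  intervalIntegral.integral_interval_sub_left
    ((continuous_integrand hN hg _).intervalIntegrable _ _)
    ((continuous_integrand hN hg _).intervalIntegrable _ _)

lemma abs_sub_le (hN : SmoothStep N) (hg : Continuous g) (w v v' : ℝ) :
    |entropy N γ g w v - entropy N γ g w v'| ≤ |v - v'| := by
  rw [sub_eq hN hg]
  simpa using intervalIntegral.norm_integral_le_of_norm_le_const (a := v') (b := v) (C := 1)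
    (f := fun y => N (g y - w)) fun y _ => hN.abs_le_one _

lemma abs_le (hN : SmoothStep N) (w v : ℝ) : |entropy N γ g w v| ≤ |v - γ w| := by
  simpa [entropy] using intervalIntegral.norm_integral_le_of_norm_le_const (a := γ w) (b := v) (C := 1)
    (f := fun y => N (g y - w)) fun y _ => hN.abs_le_one _

lemma sub_le (hN : SmoothStep N) (hg : Continuous g) (hgm : Monotone g) (w v v' : ℝ) :
    entropy N γ g w v - entropy N γ g w v' ≤ (v - v') * N (g v - w) := by
  rw [sub_eq hN hg]
  have hi := fun a b => (continuous_integrand hN hg w).intervalIntegrable (μ := volume) a b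
  have hmono : ∀ {x y}, x ≤ y → N (g x - w) ≤ N (g y - w) := fun h =>
    hN.monotone (sub_le_sub_right (hgm h) _)
  rcases le_total v' v with h | h
  · have := intervalIntegral.integral_mono_on h (hi v' v)
      (intervalIntegrable_const (c := N (g v - w))) fun y hy => hmono hy.2
    simpa using this
  · have := intervalIntegral.integral_mono_on h (intervalIntegrable_const (c := N (g v - w)))
      (hi v v') fun y hy => hmono hy.1
    rw [intervalIntegral.integral_symm]
    simp only [intervalIntegral.integral_const, smul_eq_mul] at this
    linarith

lemma tendsto_posStep (hg' : ∀ r, g (γ r) = r) (hg : Continuous g)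
    (hgm : StrictMono g) (w v : ℝ) :
    Tendsto (fun n => entropy (posStep n) γ g w v) atTop (𝓝 (max (v - γ w) 0)) := by
  rcases le_total v (γ w) with h | h
  · rw [max_eq_right (by linarith)]
    refine tendsto_const_nhds.congr fun n => ?_
    rw [entropy, intervalIntegral.integral_congr (g := fun _ => (0:ℝ))]
    · simp
    · intro y hy
      rw [uIcc_of_ge h] at hy
      refine posStep_of_nonpos n ?_
      have := hgm.monotone hy.2
      rw [hg'] at this
      linarith
  · rw [max_eq_left (by linarith)]
    have : v - γ w = ∫ y in (γ w)..v, (1:ℝ) := by simp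
    rw [this]
    refine intervalIntegral.tendsto_integral_filter_of_dominated_convergence (fun _ => 1)
      (Eventually.of_forall fun n => (continuous_integrand (smoothStep_posStep n) hg
        w).aestronglyMeasurable)
      (Eventually.of_forall fun n => Eventually.of_forall fun y _ =>
        (smoothStep_posStep n).abs_le_one _) intervalIntegrable_const
      (Eventually.of_forall fun y hy => ?_)
    rw [uIoc_of_le h] at hy
    refine _root_.tendsto_posStep ?_
    have := hgm hy.1
    rw [hg'] at this
    linarith

lemma tendsto_negStep (hg' : ∀ r, g (γ r) = r) (hg : Continuous g)
    (hgm : StrictMono g) (w v : ℝ) :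
    Tendsto (fun n => entropy (negStep n) γ g w v) atTop (𝓝 (max (γ w - v) 0)) := by
  rcases le_total (γ w) v with h | h
  · rw [max_eq_right (by linarith)]
    refine tendsto_const_nhds.congr fun n => ?_
    rw [entropy, intervalIntegral.integral_congr (g := fun _ => (0:ℝ))]
    · simp
    · intro y hy
      rw [uIcc_of_le h] at hy
      have := hgm.monotone hy.1
      rw [hg'] at this
      simp only [negStep]
      rw [posStep_of_nonpos n (by linarith), neg_zero]
  · rw [max_eq_left (by linarith)]
    have : γ w - v = ∫ y in (γ w)..v, (-1:ℝ) := by simp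
    rw [this]
    refine intervalIntegral.tendsto_integral_filter_of_dominated_convergence (fun _ => 1)
      (Eventually.of_forall fun n => (continuous_integrand (smoothStep_negStep n) hg
        w).aestronglyMeasurable)
      (Eventually.of_forall fun n => Eventually.of_forall fun y _ =>
        (smoothStep_negStep n).abs_le_one _) intervalIntegrable_const
      ?_
    have hne : ∀ᵐ y : ℝ, y ≠ γ w := by simp [ae_iff, measure_singleton]
    filter_upwards [hne] with y hy0 hy
    rw [uIoc_of_ge h] at hy
    refine (_root_.tendsto_posStep ?_).neg
    have := hgm (lt_of_le_of_ne hy.2 hy0)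
    rw [hg'] at this
    linarith

end entropy

lemma entropy.integrable {N γ g : ℝ → ℝ} (hN : SmoothStep N) (hγ : Continuous γ)
    (hg : Continuous g) {α : Type*} [MeasurableSpace α] {μ : Measure α} {w v : α → ℝ}
    (hw : AEStronglyMeasurable w μ) (hγw : Integrable (fun x => γ (w x)) μ)
    (hv : Integrable v μ) : Integrable (fun x => entropy N γ g (w x) (v x)) μ :=
  (hv.sub hγw).mono ((entropy.continuous hN hγ hg).comp_aestronglyMeasurable
    (hw.prodMk hv.aestronglyMeasurable)) (Eventually.of_forall fun _ => entropy.abs_le hN _ _)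

namespace RegularSolution

variable {G : MetricGraph} {p : G.E → ℝ} {γ : G.E → ℝ → ℝ} {T : ℝ}
  {v U D F : ℝ → G.E → ℝ → ℝ} {Z W : ℝ → G.V → ℝ}

lemma memLp_D (S : RegularSolution G p γ T v U D F Z W) (hp : ∀ e, 1 < p e) (e : G.E) :
    MemLp (fun q : ℝ × ℝ => D q.1 e q.2) (ENNReal.ofReal (p e))
      ((volume.restrict (Ioo 0 T)).prod (G.edgeMeasure e)) :=
  memLp_of_integrable_rpow (by linarith [hp e]) (S.measurable_D e).aestronglyMeasurable
    (S.integrable_D e)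

lemma diagonalRegular_weakForm (S : RegularSolution G p γ T v U D F Z W) (hp : ∀ e, 1 < p e)
    {a b : ℝ} (ha : 0 < a) (hbT : b ≤ T) {φ φ' : ℝ → G.E → ℝ → ℝ} {φV : ℝ → G.V → ℝ}
    (hφm : ∀ e, Measurable fun q : ℝ × ℝ => φ q.1 e q.2)
    (hφ'm : ∀ e, Measurable fun q : ℝ × ℝ => φ' q.1 e q.2)
    (hφVm : ∀ z, Measurable fun t => φV t z) (hφ : ∀ t e x, |φ t e x| ≤ 1)
    (hφ' : ∀ e, MemLp (fun q : ℝ × ℝ => φ' q.1 e q.2) (ENNReal.ofReal (p e))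
      ((volume.restrict (Ioo a b)).prod (G.edgeMeasure e)))
    (hφV : ∀ t z, |φV t z| ≤ 1) :
    DiagonalRegular a b fun τ t => weakForm G p (F τ) (D τ) (W τ) (φ t) (φ' t) (φV t) := by
  refine DiagonalRegular.add ha (DiagonalRegular.sum _ ha fun e _ => ?_)
    (DiagonalRegular.sum _ ha fun z _ => ?_)
  · have := holderConjugate_ofReal (hp e)
    have h1 : Fact (1 ≤ ENNReal.ofReal (p e / (p e - 1))) := ⟨by
      rw [ENNReal.one_le_ofReal, one_le_div] <;> linarith [hp e]⟩
    have h2 : Fact (1 ≤ ENNReal.ofReal (p e)) := ⟨by simpa using (hp e).le⟩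
    have hF : DiagonalRegular a b fun τ t => ∫ x, F τ e x * φ t e x ∂G.edgeMeasure e :=
      DiagonalRegular.pairing (q := 1) (q' := ∞) ENNReal.one_ne_top ha hbT (S.measurable_F e)
        (hφm e) (memLp_one_iff_integrable.2 (S.integrable_F e))
        (memLp_top_of_abs_le (hφm e).aestronglyMeasurable
          (Eventually.of_forall fun q => hφ q.1 e q.2))
    have hD : DiagonalRegular a b fun τ t =>
        ∫ x, rho (p e) (D τ e x) * φ' t e x ∂G.edgeMeasure e :=
      DiagonalRegular.pairing (K := fun q : ℝ × ℝ => rho (p e) (D q.1 e q.2))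
        (q := ENNReal.ofReal (p e / (p e - 1))) (q' := ENNReal.ofReal (p e))
        ENNReal.ofReal_ne_top ha hbT ((measurable_rho _).comp (S.measurable_D e))
        (hφ'm e) (memLp_rho (hp e) (S.measurable_D e) (S.integrable_D e)) (hφ' e)
    simpa only [sub_eq_add_neg] using hF.add ha hD.neg
  · have := DiagonalRegular.pairing (ν := Measure.dirac 0) (q := 1) (q' := ∞)
      (K := fun q : ℝ × ℝ => W q.1 z) (φ := fun q : ℝ × ℝ => φV q.1 z) ENNReal.one_ne_top ha hbT
      ((S.measurable_W z).comp measurable_fst) ((hφVm z).comp measurable_fst)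
      (memLp_one_iff_integrable.2 ((S.integrable_W z).comp_fst _))
      (memLp_top_of_abs_le ((hφVm z).comp measurable_fst).aestronglyMeasurable
          (Eventually.of_forall fun q => hφV q.1 z))
    simpa using this

lemma entropy_le (S : RegularSolution G p γ T v U D F Z W) (hp : ∀ e, 1 < p e)
    {g : G.E → ℝ → ℝ} (hγ : ∀ e, Continuous (γ e)) (hg : ∀ e, Continuous (g e))
    (hgγ : ∀ e r, g e (γ e r) = r) (hgm : ∀ e, Monotone (g e)) {N : ℝ → ℝ} (hN : SmoothStep N)
    {w w' : G.E → ℝ → ℝ} {wV : G.V → ℝ} (hw : GraphSobolev G p w w' wV)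
    (hwm : ∀ e, Measurable (w e)) (hw'm : ∀ e, Measurable (w' e))
    (hγw : ∀ e, Integrable (fun x => γ e (w e x)) (G.edgeMeasure e))
    {a b : ℝ} (ha : 0 < a) (hab : a < b) (hbT : b < T) :
    (∑ e, ∫ x, entropy N (γ e) (g e) (w e x) (v b e x) ∂G.edgeMeasure e) -
      ∑ e, ∫ x, entropy N (γ e) (g e) (w e x) (v a e x) ∂G.edgeMeasure e ≤
    ∫ t in Ioo a b, weakForm G p (F t) (D t) (W t) (fun e x => N (U t e x - w e x))
      (fun e x => deriv N (U t e x - w e x) * (D t e x - w' e x)) (fun z => N (Z t z - wV z)) := by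
  obtain ⟨C, hC⟩ := hN.exists_abs_deriv_le
  have hNm := hN.contDiff.continuous.measurable
  have hdNm : Measurable (deriv N) := measurable_deriv N
  have hUw : ∀ e, Measurable fun q : ℝ × ℝ => U q.1 e q.2 - w e q.2 := fun e =>
    (S.measurable_U e).sub ((hwm e).comp measurable_snd)
  have hDw : ∀ e, Measurable fun q : ℝ × ℝ => D q.1 e q.2 - w' e q.2 := fun e =>
    (S.measurable_D e).sub ((hw'm e).comp measurable_snd)
  have hent : ∀ t ∈ Icc 0 T, ∀ e, Integrable
      (fun x => entropy N (γ e) (g e) (w e x) (v t e x)) (G.edgeMeasure e) := fun t ht e =>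
    entropy.integrable hN (hγ e) (hg e) (hwm e).aestronglyMeasurable (hγw e)
      (S.integrable_v t ht e)
  refine DiagonalRegular.sub_le_integral_diag (β := fun t =>
    ∑ e, ∫ x, entropy N (γ e) (g e) (w e x) (v t e x) ∂G.edgeMeasure e) ha hab
    (S.diagonalRegular_weakForm (φ := fun t e x => N (U t e x - w e x))
      (φ' := fun t e x => deriv N (U t e x - w e x) * (D t e x - w' e x))
      (φV := fun t z => N (Z t z - wV z)) hp ha hbT.le
      (fun e => hNm.comp (hUw e)) (fun e => (hdNm.comp (hUw e)).mul (hDw e))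
      (fun z => hNm.comp ((S.measurable_Z z).sub_const _)) (fun _ _ _ => hN.abs_le_one _)
      (fun e => ?_) fun _ _ => hN.abs_le_one _) ?_ ?_
  · have h1 : MemLp (fun q : ℝ × ℝ => D q.1 e q.2) (ENNReal.ofReal (p e))
        ((volume.restrict (Ioo a b)).prod (G.edgeMeasure e)) :=
      (S.memLp_D hp e).mono_measure (Measure.prod_mono
        (Measure.restrict_mono (Ioo_subset_Ioo ha.le hbT.le) le_rfl) le_rfl)
    have h2 : MemLp (fun q : ℝ × ℝ => w' e q.2) (ENNReal.ofReal (p e))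
        ((volume.restrict (Ioo a b)).prod (G.edgeMeasure e)) :=
      ((hw.1 e).memLp (by linarith [hp e])).comp_snd (volume.restrict (Ioo a b))
    refine (h1.sub h2).of_le_mul (c := C)
      ((hdNm.comp (hUw e)).mul (hDw e)).aestronglyMeasurable (Eventually.of_forall fun q => ?_)
    rw [norm_mul]
    exact mul_le_mul_of_nonneg_right (hC _) (norm_nonneg _)
  · refine (continuousOn_finsetSum _ fun e _ s hs => ?_ : ContinuousOn _ (Icc 0 T)).mono
      (Icc_subset_Icc_right hbT.le)
    refine tendsto_iff_dist_tendsto_zero.2 (squeeze_zero'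
      (Eventually.of_forall fun _ => dist_nonneg) ?_ (S.tendsto_v e s hs))
    filter_upwards [self_mem_nhdsWithin] with t ht
    rw [Real.dist_eq, ← integral_sub (hent t ht e) (hent s hs e)]
    exact abs_integral_le_integral_abs.trans (integral_mono
      ((hent t ht e).sub (hent s hs e)).abs
      ((S.integrable_v t ht e).sub (S.integrable_v s hs e)).abs
      fun x => entropy.abs_sub_le hN (hg e) _ _ _)
  · have hsub : Ioo a b ⊆ Ioo 0 T := Ioo_subset_Ioo ha.le hbT.le
    filter_upwards [ae_restrict_of_ae_restrict_of_subset hsub S.sobolev,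
      ae_restrict_of_ae_restrict_of_subset hsub S.v_eq, ae_restrict_mem measurableSet_Ioo]
      with t ht hvt htm h hh
    have hφ := GraphSobolev.comp_sub hp ht hw hN.contDiff hC
    have h0 : 0 < t - h := by linarith [htm.1, hh.2]
    have htT : t < T := htm.2.trans hbT
    have htI : t ∈ Icc 0 T := ⟨by linarith [htm.1], htT.le⟩
    have hthI : t - h ∈ Icc 0 T := ⟨h0.le, by linarith [hh.1]⟩
    rw [← S.sub_eq _ _ _ hφ (t - h) t h0 (by linarith [hh.1]) htT, ← Finset.sum_sub_distrib]
    refine Finset.sum_le_sum fun e _ => ?_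
    rw [← integral_sub (hent t htI e) (hent _ hthI e)]
    refine integral_mono_ae ((hent t htI e).sub (hent _ hthI e)) ?_ ?_
    · exact (memLp_one_iff_integrable.2 ((S.integrable_v t htI e).sub
        (S.integrable_v _ hthI e))).integrable_mul ((hφ.1 e).memLp_top (G.len_pos e))
    · filter_upwards [hvt e] with x hx
      have := entropy.sub_le (γ := γ e) hN (hg e) (hgm e) (w e x) (v t e x) (v (t - h) e x)
      rwa [hx, hgγ, ← hx] at this

end RegularSolution

section
variable {α β δ : Type*} [MeasurableSpace α] [MeasurableSpace β] [MeasurableSpace δ]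
  {μ : Measure α} {κ : Measure β} {ν : Measure δ} [IsFiniteMeasure μ] [IsFiniteMeasure κ]
  [SFinite ν] {q : ℝ≥0∞}

lemma MeasureTheory.MemLp.lift_snd {f : β × δ → ℝ} (hf : MemLp f q (κ.prod ν)) :
    MemLp (fun r : (α × β) × δ => f (r.1.2, r.2)) q ((μ.prod κ).prod ν) :=
  (hf.comp_snd μ).comp_measurePreserving (measurePreserving_prodAssoc μ κ ν)

lemma MeasureTheory.MemLp.lift_fst {f : α × δ → ℝ} (hf : MemLp f q (μ.prod ν)) :
    MemLp (fun r : (α × β) × δ => f (r.1.1, r.2)) q ((μ.prod κ).prod ν) :=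
  (hf.lift_snd (μ := κ)).comp_measurePreserving
    ((Measure.measurePreserving_swap (μ := μ) (ν := κ)).prod (MeasurePreserving.id ν))

end

namespace RegularSolution

variable {G : MetricGraph} {p : G.E → ℝ} {γ : G.E → ℝ → ℝ} {T : ℝ}
  {v U D F : ℝ → G.E → ℝ → ℝ} {Z W : ℝ → G.V → ℝ}

lemma integrable_comp_U (S : RegularSolution G p γ T v U D F Z W) (hγ : ∀ e, Continuous (γ e))
    (e : G.E) : Integrable (fun q : ℝ × ℝ => γ e (U q.1 e q.2))
      ((volume.restrict (Ioo 0 T)).prod (G.edgeMeasure e)) := by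
  have hm : Measurable fun q : ℝ × ℝ => γ e (U q.1 e q.2) :=
    (hγ e).measurable.comp (S.measurable_U e)
  rw [integrable_prod_iff hm.aestronglyMeasurable]
  have hc : ContinuousOn (fun t => ∫ x, |v t e x| ∂G.edgeMeasure e) (Icc 0 T) := by
    intro s hs
    refine tendsto_iff_dist_tendsto_zero.2 (squeeze_zero'
      (Eventually.of_forall fun _ => dist_nonneg) ?_ (S.tendsto_v e s hs))
    filter_upwards [self_mem_nhdsWithin] with t ht
    rw [Real.dist_eq, ← integral_sub (S.integrable_v t ht e).abs (S.integrable_v s hs e).abs]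
    exact abs_integral_le_integral_abs.trans (integral_mono
      ((S.integrable_v t ht e).abs.sub (S.integrable_v s hs e).abs).abs
      ((S.integrable_v t ht e).sub (S.integrable_v s hs e)).abs
      fun x => abs_abs_sub_abs_le _ _)
  refine ⟨?_, (hc.integrableOn_Icc.mono_set Ioo_subset_Icc_self).congr ?_⟩
  · filter_upwards [S.v_eq, ae_restrict_mem measurableSet_Ioo] with t h1 ht
    exact (S.integrable_v t (Ioo_subset_Icc_self ht) e).congr (h1 e)
  · filter_upwards [S.v_eq] with t h1
    refine integral_congr_ae ?_
    filter_upwards [h1 e] with x hx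
    rw [hx, Real.norm_eq_abs]

lemma integrable_weakForm (S : RegularSolution G p γ T v U D F Z W) (hp : ∀ e, 1 < p e)
    {μ : Measure ℝ} [IsFiniteMeasure μ]
    {φ φ' : ℝ × ℝ → G.E → ℝ → ℝ} {φV : ℝ × ℝ → G.V → ℝ}
    (hφm : ∀ e, Measurable fun q : (ℝ × ℝ) × ℝ => φ q.1 e q.2)
    (hφVm : ∀ z, Measurable fun q => φV q z) (hφ : ∀ q e x, |φ q e x| ≤ 1)
    (hφ' : ∀ e, MemLp (fun q : (ℝ × ℝ) × ℝ => φ' q.1 e q.2) (ENNReal.ofReal (p e))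
      (((volume.restrict (Ioo 0 T)).prod μ).prod (G.edgeMeasure e)))
    (hφV : ∀ q z, |φV q z| ≤ 1) :
    Integrable (fun q => weakForm G p (F q.1) (D q.1) (W q.1) (φ q) (φ' q) (φV q))
      ((volume.restrict (Ioo 0 T)).prod μ) := by
  refine (integrable_finsetSum _ fun e _ => ?_).add (integrable_finsetSum _ fun z _ => ?_)
  · have := holderConjugate_ofReal (hp e)
    refine Integrable.sub (Integrable.integral_prod_left (f := fun q : (ℝ × ℝ) × ℝ =>
      F q.1.1 e q.2 * φ q.1 e q.2) ?_) (Integrable.integral_prod_left (f := fun q : (ℝ × ℝ) × ℝ =>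
      rho (p e) (D q.1.1 e q.2) * φ' q.1 e q.2) ?_)
    · exact (memLp_one_iff_integrable.2 (S.integrable_F e)).lift_fst.integrable_mul
        (memLp_top_of_abs_le (hφm e).aestronglyMeasurable
          (Eventually.of_forall fun q => hφ q.1 e q.2))
    · exact (memLp_rho (hp e) (S.measurable_D e) (S.integrable_D e)).lift_fst.integrable_mul (hφ' e)
  · exact (memLp_one_iff_integrable.2 ((S.integrable_W z).comp_fst μ)).integrable_mul
      (memLp_top_of_abs_le (hφVm z).aestronglyMeasurable
          (Eventually.of_forall fun q => hφV q z))

lemma tendsto_integral_entropy (S : RegularSolution G p γ T v U D F Z W)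
    {g : G.E → ℝ → ℝ} (hγ : ∀ e, Continuous (γ e)) (hg : ∀ e, Continuous (g e))
    {N : ℕ → ℝ → ℝ} (hN : ∀ n, SmoothStep (N n)) {H : ℝ → ℝ → ℝ}
    (hH : ∀ e w r, Tendsto (fun n => entropy (N n) (γ e) (g e) w r) atTop (𝓝 (H (γ e w) r)))
    {c d : ℝ} (hc : 0 ≤ c) (hd : d ≤ T) {r : G.E → ℝ → ℝ}
    (hr : ∀ e, Integrable (r e) (G.edgeMeasure e)) :
    (∀ n, IntegrableOn (fun s => ∑ e, ∫ x, entropy (N n) (γ e) (g e) (U s e x) (r e x)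
      ∂G.edgeMeasure e) (Ioo c d)) ∧
    Tendsto (fun n => ∫ s in Ioo c d, ∑ e, ∫ x, entropy (N n) (γ e) (g e) (U s e x) (r e x)
      ∂G.edgeMeasure e) atTop
      (𝓝 (∫ s in Ioo c d, ∑ e, ∫ x, H (v s e x) (r e x) ∂G.edgeMeasure e)) := by
  have hsub : Ioo c d ⊆ Ioo 0 T := Ioo_subset_Ioo hc hd
  have hle : ∀ e, (volume.restrict (Ioo c d)).prod (G.edgeMeasure e) ≤
      (volume.restrict (Ioo 0 T)).prod (G.edgeMeasure e) := fun e =>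
    Measure.prod_mono (Measure.restrict_mono hsub le_rfl) le_rfl
  have hγU := fun e => (S.integrable_comp_U hγ e).mono_measure (hle e)
  have hre : ∀ e, Integrable (fun q : ℝ × ℝ => r e q.2)
      ((volume.restrict (Ioo c d)).prod (G.edgeMeasure e)) := fun e => (hr e).comp_snd _
  have hi : ∀ n e, Integrable (fun q : ℝ × ℝ => entropy (N n) (γ e) (g e) (U q.1 e q.2) (r e q.2))
      ((volume.restrict (Ioo c d)).prod (G.edgeMeasure e)) := fun n e =>
    entropy.integrable (hN n) (hγ e) (hg e) (S.measurable_U e).aestronglyMeasurable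
      (hγU e) (hre e)
  have hbd : ∀ e, Integrable (fun q : ℝ × ℝ => |r e q.2 - γ e (U q.1 e q.2)|)
      ((volume.restrict (Ioo c d)).prod (G.edgeMeasure e)) := fun e => ((hre e).sub (hγU e)).abs
  have hHi : ∀ e, Integrable (fun q : ℝ × ℝ => H (γ e (U q.1 e q.2)) (r e q.2))
      ((volume.restrict (Ioo c d)).prod (G.edgeMeasure e)) := fun e =>
    (hbd e).mono (aestronglyMeasurable_of_tendsto_ae atTop
      (fun n => (hi n e).aestronglyMeasurable) (Eventually.of_forall fun q => hH _ _ _))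
      (Eventually.of_forall fun q => by
        rw [Real.norm_eq_abs, Real.norm_eq_abs, abs_abs]
        exact le_of_tendsto (hH _ _ _).abs
          (Eventually.of_forall fun n => entropy.abs_le (hN n) _ _))
  refine ⟨fun n => integrable_finsetSum _ fun e _ => (hi n e).integral_prod_left, ?_⟩
  have hv : ∫ s in Ioo c d, ∑ e, ∫ x, H (v s e x) (r e x) ∂G.edgeMeasure e =
      ∫ s in Ioo c d, ∑ e, ∫ x, H (γ e (U s e x)) (r e x) ∂G.edgeMeasure e := by
    refine integral_congr_ae ?_
    filter_upwards [ae_restrict_of_ae_restrict_of_subset hsub S.v_eq] with s hs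
    refine Finset.sum_congr rfl fun e _ => integral_congr_ae ?_
    filter_upwards [hs e] with x hx
    rw [hx]
  rw [hv, integral_finsetSum _ fun e _ => (hHi e).integral_prod_left]
  simp_rw [fun n => integral_finsetSum (μ := volume.restrict (Ioo c d)) Finset.univ
    (f := fun e s => ∫ x, entropy (N n) (γ e) (g e) (U s e x) (r e x) ∂G.edgeMeasure e)
    fun e _ => (hi n e).integral_prod_left]
  refine tendsto_finsetSum _ fun e _ => ?_
  have := tendsto_integral_of_dominated_convergence _
    (fun n => (hi n e).aestronglyMeasurable) (hbd e)
    (fun n => Eventually.of_forall fun q => entropy.abs_le (hN n) _ _)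
    (Eventually.of_forall fun q => hH e (U q.1 e q.2) (r e q.2))
  rw [integral_prod _ (hHi e)] at this
  simp_rw [fun n => integral_prod _ (hi n e)] at this
  exact this

end RegularSolution

/-- The positive parts of the differences of the sources and of the vertex fluxes. -/
noncomputable def dataGap (G : MetricGraph) (F₁ F₂ : G.E → ℝ → ℝ) (W₁ W₂ : G.V → ℝ) : ℝ :=
  ∑ e, (∫ x, max (F₁ e x - F₂ e x) 0 ∂G.edgeMeasure e) + ∑ z, max (W₁ z - W₂ z) 0

lemma weakForm_add_le_dataGap {G : MetricGraph} {p : G.E → ℝ} (hp : ∀ e, 1 < p e)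
    {F₁ F₂ D₁ D₂ φ δ : G.E → ℝ → ℝ} {W₁ W₂ φV : G.V → ℝ}
    (hF₁ : ∀ e, Integrable (F₁ e) (G.edgeMeasure e))
    (hF₂ : ∀ e, Integrable (F₂ e) (G.edgeMeasure e))
    (hDm₁ : ∀ e, Measurable (D₁ e)) (hDm₂ : ∀ e, Measurable (D₂ e))
    (hD₁ : ∀ e, Integrable (fun x => |D₁ e x| ^ p e) (G.edgeMeasure e))
    (hD₂ : ∀ e, Integrable (fun x => |D₂ e x| ^ p e) (G.edgeMeasure e))
    (hφm : ∀ e, Measurable (φ e)) (hφ0 : ∀ e x, 0 ≤ φ e x) (hφ1 : ∀ e x, φ e x ≤ 1)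
    (hδm : ∀ e, Measurable (δ e)) (hδ0 : ∀ e x, 0 ≤ δ e x) {C : ℝ} (hδC : ∀ e x, |δ e x| ≤ C)
    (hV0 : ∀ z, 0 ≤ φV z) (hV1 : ∀ z, φV z ≤ 1) :
    weakForm G p F₁ D₁ W₁ φ (fun e x => δ e x * (D₁ e x - D₂ e x)) φV +
      weakForm G p F₂ D₂ W₂ (fun e x => -φ e x) (fun e x => δ e x * (D₂ e x - D₁ e x))
        (fun z => -φV z) ≤ dataGap G F₁ F₂ W₁ W₂ := by
  have hmul : ∀ a c : ℝ, 0 ≤ c → c ≤ 1 → a * c ≤ max a 0 := fun a c h0 h1 =>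
    (mul_le_mul_of_nonneg_right (le_max_left a 0) h0).trans
      (mul_le_of_le_one_right (le_max_right a 0) h1)
  have hLp : ∀ e, MemLp (D₁ e) (ENNReal.ofReal (p e)) (G.edgeMeasure e) ∧
      MemLp (D₂ e) (ENNReal.ofReal (p e)) (G.edgeMeasure e) := fun e =>
    ⟨memLp_of_integrable_rpow (by linarith [hp e]) (hDm₁ e).aestronglyMeasurable (hD₁ e),
      memLp_of_integrable_rpow (by linarith [hp e]) (hDm₂ e).aestronglyMeasurable (hD₂ e)⟩
  have hδLp : ∀ e {h : ℝ → ℝ}, Measurable h → MemLp h (ENNReal.ofReal (p e)) (G.edgeMeasure e) →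
      MemLp (fun x => δ e x * h x) (ENNReal.ofReal (p e)) (G.edgeMeasure e) := fun e h hm hh =>
    hh.of_le_mul (c := C) ((hδm e).mul hm).aestronglyMeasurable (Eventually.of_forall fun x => by
      rw [norm_mul]
      exact mul_le_mul_of_nonneg_right (hδC e x) (norm_nonneg _))
  have hedge : ∀ e, ((∫ x, F₁ e x * φ e x ∂G.edgeMeasure e) -
      ∫ x, rho (p e) (D₁ e x) * (δ e x * (D₁ e x - D₂ e x)) ∂G.edgeMeasure e) +
      ((∫ x, F₂ e x * -φ e x ∂G.edgeMeasure e) -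
      ∫ x, rho (p e) (D₂ e x) * (δ e x * (D₂ e x - D₁ e x)) ∂G.edgeMeasure e) ≤
      ∫ x, max (F₁ e x - F₂ e x) 0 ∂G.edgeMeasure e := by
    intro e
    have htop : MemLp (φ e) ⊤ (G.edgeMeasure e) := memLp_top_of_abs_le
      (hφm e).aestronglyMeasurable (Eventually.of_forall fun x => by
        rw [abs_of_nonneg (hφ0 e x)]
        exact hφ1 e x)
    have h1 := (memLp_one_iff_integrable.2 (hF₁ e)).integrable_mul htop
    have h2 := (memLp_one_iff_integrable.2 (hF₂ e)).integrable_mul htop.neg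
    have h3 := integrable_rho_mul (hp e) (hDm₁ e) (hD₁ e)
      (hδLp e ((hDm₁ e).sub (hDm₂ e)) ((hLp e).1.sub (hLp e).2))
    have h4 := integrable_rho_mul (hp e) (hDm₂ e) (hD₂ e)
      (hδLp e ((hDm₂ e).sub (hDm₁ e)) ((hLp e).2.sub (hLp e).1))
    refine (add_sub_add_comm _ _ _ _).symm.le.trans ?_
    refine (congrArg₂ (· - ·) (integral_add h1 h2) (integral_add h3 h4)).symm.le.trans ?_
    refine (integral_sub (h1.add h2) (h3.add h4)).symm.le.trans ?_
    refine integral_mono ((h1.add h2).sub (h3.add h4)) ((hF₁ e).sub (hF₂ e)).pos_part fun x => ?_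
    have hm : 0 ≤ (rho (p e) (D₁ e x) - rho (p e) (D₂ e x)) * (D₁ e x - D₂ e x) := by
      rcases le_total (D₁ e x) (D₂ e x) with h | h
      · exact mul_nonneg_of_nonpos_of_nonpos (sub_nonpos.2 (rho_monotone (hp e) h))
          (sub_nonpos.2 h)
      · exact mul_nonneg (sub_nonneg.2 (rho_monotone (hp e) h)) (sub_nonneg.2 h)
    have := hmul (F₁ e x - F₂ e x) _ (hφ0 e x) (hφ1 e x)
    have := mul_nonneg (hδ0 e x) hm
    simp only [Pi.add_apply, Pi.sub_apply, Pi.mul_apply, Pi.neg_apply]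
    linarith
  unfold weakForm dataGap
  rw [add_add_add_comm, ← Finset.sum_add_distrib, ← Finset.sum_add_distrib]
  refine add_le_add (Finset.sum_le_sum fun e _ => hedge e) (Finset.sum_le_sum fun z _ => ?_)
  have := hmul (W₁ z - W₂ z) _ (hV0 z) (hV1 z)
  linarith

namespace RegularSolution

variable {G : MetricGraph} {p : G.E → ℝ} {γ : G.E → ℝ → ℝ} {T : ℝ}
  {v₁ U₁ D₁ F₁ v₂ U₂ D₂ F₂ : ℝ → G.E → ℝ → ℝ} {Z₁ W₁ Z₂ W₂ : ℝ → G.V → ℝ}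

lemma integrable_crossForm (S₁ : RegularSolution G p γ T v₁ U₁ D₁ F₁ Z₁ W₁)
    (S₂ : RegularSolution G p γ T v₂ U₂ D₂ F₂ Z₂ W₂) (hp : ∀ e, 1 < p e)
    {N : ℝ → ℝ} (hN : SmoothStep N) :
    Integrable (fun q : ℝ × ℝ => weakForm G p (F₁ q.1) (D₁ q.1) (W₁ q.1)
      (fun e x => N (U₁ q.1 e x - U₂ q.2 e x))
      (fun e x => deriv N (U₁ q.1 e x - U₂ q.2 e x) * (D₁ q.1 e x - D₂ q.2 e x))
      (fun z => N (Z₁ q.1 z - Z₂ q.2 z)))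
      ((volume.restrict (Ioo 0 T)).prod (volume.restrict (Ioo 0 T))) := by
  obtain ⟨C, hC⟩ := hN.exists_abs_deriv_le
  have hNm := hN.contDiff.continuous.measurable
  have hdNm : Measurable (deriv N) := measurable_deriv N
  have hfst : Measurable fun q : (ℝ × ℝ) × ℝ => (q.1.1, q.2) := by fun_prop
  have hsnd : Measurable fun q : (ℝ × ℝ) × ℝ => (q.1.2, q.2) := by fun_prop
  have hU : ∀ e, Measurable fun q : (ℝ × ℝ) × ℝ => U₁ q.1.1 e q.2 - U₂ q.1.2 e q.2 := fun e =>
    ((S₁.measurable_U e).comp hfst).sub ((S₂.measurable_U e).comp hsnd)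
  have hD : ∀ e, Measurable fun q : (ℝ × ℝ) × ℝ => D₁ q.1.1 e q.2 - D₂ q.1.2 e q.2 := fun e =>
    ((S₁.measurable_D e).comp hfst).sub ((S₂.measurable_D e).comp hsnd)
  refine S₁.integrable_weakForm hp (φ := fun q e x => N (U₁ q.1 e x - U₂ q.2 e x))
      (φ' := fun q e x => deriv N (U₁ q.1 e x - U₂ q.2 e x) * (D₁ q.1 e x - D₂ q.2 e x))
      (φV := fun q z => N (Z₁ q.1 z - Z₂ q.2 z)) (fun e => hNm.comp (hU e))
    (fun z => hNm.comp (((S₁.measurable_Z z).comp measurable_fst).sub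
      ((S₂.measurable_Z z).comp measurable_snd)))
    (fun _ _ _ => hN.abs_le_one _) (fun e => ?_) (fun _ _ => hN.abs_le_one _)
  refine ((S₁.memLp_D hp e).lift_fst.sub (S₂.memLp_D hp e).lift_snd).of_le_mul (c := C)
    ((hdNm.comp (hU e)).mul (hD e)).aestronglyMeasurable (Eventually.of_forall fun q => ?_)
  rw [norm_mul]
  exact mul_le_mul_of_nonneg_right (hC _) (norm_nonneg _)

lemma integrable_dataGap (S₁ : RegularSolution G p γ T v₁ U₁ D₁ F₁ Z₁ W₁)
    (S₂ : RegularSolution G p γ T v₂ U₂ D₂ F₂ Z₂ W₂) :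
    Integrable (fun q : ℝ × ℝ => dataGap G (F₁ q.1) (F₂ q.2) (W₁ q.1) (W₂ q.2))
      ((volume.restrict (Ioo 0 T)).prod (volume.restrict (Ioo 0 T))) := by
  refine (integrable_finsetSum _ fun e _ => ?_).add (integrable_finsetSum _ fun z _ => ?_)
  · exact Integrable.integral_prod_left (f := fun q : (ℝ × ℝ) × ℝ =>
      max (F₁ q.1.1 e q.2 - F₂ q.1.2 e q.2) 0) (memLp_one_iff_integrable.1
        ((memLp_one_iff_integrable.2 (S₁.integrable_F e)).lift_fst.sub
          (memLp_one_iff_integrable.2 (S₂.integrable_F e)).lift_snd)).pos_part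
  · exact (((S₁.integrable_W z).comp_fst _).sub ((S₂.integrable_W z).comp_snd _)).pos_part

end RegularSolution

/-- The `L¹` norm of the positive part of `v - w`. -/
noncomputable def posDist (G : MetricGraph) (v w : G.E → ℝ → ℝ) : ℝ :=
  ∑ e, ∫ x, max (v e x - w e x) 0 ∂G.edgeMeasure e

namespace RegularSolution

variable {G : MetricGraph} {p : G.E → ℝ} {γ : G.E → ℝ → ℝ} {T : ℝ}
  {v U D F v₁ U₁ D₁ F₁ v₂ U₂ D₂ F₂ : ℝ → G.E → ℝ → ℝ} {Z W Z₁ W₁ Z₂ W₂ : ℝ → G.V → ℝ}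

lemma ae_slice (S : RegularSolution G p γ T v U D F Z W) (hγ : ∀ e, Continuous (γ e)) :
    ∀ᵐ t ∂(volume.restrict (Ioo 0 T)), GraphSobolev G p (U t) (D t) (Z t) ∧
      ∀ e, Integrable (F t e) (G.edgeMeasure e) ∧
      Integrable (fun x => |D t e x| ^ p e) (G.edgeMeasure e) ∧
      Integrable (fun x => γ e (U t e x)) (G.edgeMeasure e) := by
  refine S.sobolev.and (ae_all_iff.2 fun e => ?_)
  exact (S.integrable_F e).prod_right_ae.and ((S.integrable_D e).prod_right_ae.and
    (S.integrable_comp_U hγ e).prod_right_ae)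

lemma entropy_doubling_le (S₁ : RegularSolution G p γ T v₁ U₁ D₁ F₁ Z₁ W₁)
    (S₂ : RegularSolution G p γ T v₂ U₂ D₂ F₂ Z₂ W₂) (hp : ∀ e, 1 < p e)
    {g : G.E → ℝ → ℝ} (hγ : ∀ e, Continuous (γ e)) (hg : ∀ e, Continuous (g e))
    (hgγ : ∀ e r, g e (γ e r) = r) (hgm : ∀ e, StrictMono (g e)) (n : ℕ)
    {a b c d : ℝ} (ha : 0 < a) (hab : a < b) (hbT : b < T) (hc : 0 < c) (hcd : c < d)
    (hdT : d < T) :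
    (∫ s in Ioo c d,
      ((∑ e, ∫ x, entropy (posStep n) (γ e) (g e) (U₂ s e x) (v₁ b e x) ∂G.edgeMeasure e) -
        ∑ e, ∫ x, entropy (posStep n) (γ e) (g e) (U₂ s e x) (v₁ a e x) ∂G.edgeMeasure e)) +
    (∫ t in Ioo a b,
      ((∑ e, ∫ x, entropy (negStep n) (γ e) (g e) (U₁ t e x) (v₂ d e x) ∂G.edgeMeasure e) -
        ∑ e, ∫ x, entropy (negStep n) (γ e) (g e) (U₁ t e x) (v₂ c e x) ∂G.edgeMeasure e)) ≤
    ∫ q, dataGap G (F₁ q.1) (F₂ q.2) (W₁ q.1) (W₂ q.2)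
      ∂((volume.restrict (Ioo a b)).prod (volume.restrict (Ioo c d))) := by
  have hab0 : Ioo a b ⊆ Ioo 0 T := Ioo_subset_Ioo ha.le hbT.le
  have hcd0 : Ioo c d ⊆ Ioo 0 T := Ioo_subset_Ioo hc.le hdT.le
  have hle : (volume.restrict (Ioo a b)).prod (volume.restrict (Ioo c d)) ≤
      (volume.restrict (Ioo 0 T)).prod (volume.restrict (Ioo 0 T)) :=
    Measure.prod_mono (Measure.restrict_mono hab0 le_rfl) (Measure.restrict_mono hcd0 le_rfl)
  have hP := (S₁.integrable_crossForm S₂ hp (smoothStep_posStep n)).mono_measure hle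
  have hQ := (S₂.integrable_crossForm S₁ hp (smoothStep_negStep n)).swap.mono_measure hle
  have hsl₁ := ae_restrict_of_ae_restrict_of_subset hab0 (S₁.ae_slice hγ)
  have hsl₂ := ae_restrict_of_ae_restrict_of_subset hcd0 (S₂.ae_slice hγ)
  have hpos := fun {r : G.E → ℝ → ℝ} (hr : ∀ e, Integrable (r e) (G.edgeMeasure e)) =>
    (S₂.tendsto_integral_entropy hγ hg smoothStep_posStep (H := fun w r => max (r - w) 0)
      (fun e => entropy.tendsto_posStep (hgγ e) (hg e) (hgm e)) hc.le hdT.le hr).1 n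
  have hneg := fun {r : G.E → ℝ → ℝ} (hr : ∀ e, Integrable (r e) (G.edgeMeasure e)) =>
    (S₁.tendsto_integral_entropy hγ hg smoothStep_negStep (H := fun w r => max (w - r) 0)
      (fun e => entropy.tendsto_negStep (hgγ e) (hg e) (hgm e)) ha.le hbT.le hr).1 n
  have h1 := integral_mono_ae
    ((hpos (S₁.integrable_v b ⟨(ha.trans hab).le, hbT.le⟩)).sub
      (hpos (S₁.integrable_v a ⟨ha.le, (hab.trans hbT).le⟩))) hP.integral_prod_right (by
    filter_upwards [hsl₂] with s hs
    exact S₁.entropy_le hp hγ hg hgγ (fun e => (hgm e).monotone) (smoothStep_posStep n) hs.1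
      (fun e => (S₂.measurable_U e).comp measurable_prodMk_left)
      (fun e => (S₂.measurable_D e).comp measurable_prodMk_left) (fun e => (hs.2 e).2.2)
      ha hab hbT)
  have h2 := integral_mono_ae
    ((hneg (S₂.integrable_v d ⟨(hc.trans hcd).le, hdT.le⟩)).sub
      (hneg (S₂.integrable_v c ⟨hc.le, (hcd.trans hdT).le⟩))) hQ.integral_prod_left (by
    filter_upwards [hsl₁] with t ht
    exact S₂.entropy_le hp hγ hg hgγ (fun e => (hgm e).monotone) (smoothStep_negStep n) ht.1
      (fun e => (S₁.measurable_U e).comp measurable_prodMk_left)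
      (fun e => (S₁.measurable_D e).comp measurable_prodMk_left) (fun e => (ht.2 e).2.2)
      hc hcd hdT)
  rw [← integral_prod_symm _ hP] at h1
  rw [← integral_prod _ hQ] at h2
  refine (add_le_add h1 h2).trans ?_
  rw [← integral_add hP hQ]
  refine integral_mono_ae (hP.add hQ) ((S₁.integrable_dataGap S₂).mono_measure hle) ?_
  filter_upwards [Measure.quasiMeasurePreserving_fst.ae hsl₁,
    Measure.quasiMeasurePreserving_snd.ae hsl₂] with q hq₁ hq₂
  obtain ⟨C, hC⟩ := (smoothStep_posStep n).exists_abs_deriv_le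
  have hU₁ := fun e => (S₁.measurable_U e).comp (measurable_prodMk_left (x := q.1))
  have hU₂ := fun e => (S₂.measurable_U e).comp (measurable_prodMk_left (x := q.2))
  have hD₁ := fun e => (S₁.measurable_D e).comp (measurable_prodMk_left (x := q.1))
  have hD₂ := fun e => (S₂.measurable_D e).comp (measurable_prodMk_left (x := q.2))
  have := weakForm_add_le_dataGap (φ := fun e x => posStep n (U₁ q.1 e x - U₂ q.2 e x))
    (δ := fun e x => deriv (posStep n) (U₁ q.1 e x - U₂ q.2 e x))
    (F₁ := F₁ q.1) (F₂ := F₂ q.2) (D₁ := D₁ q.1) (D₂ := D₂ q.2) (W₁ := W₁ q.1) (W₂ := W₂ q.2)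
    (φV := fun z => posStep n (Z₁ q.1 z - Z₂ q.2 z)) hp
    (fun e => (hq₁.2 e).1) (fun e => (hq₂.2 e).1) hD₁ hD₂
    (fun e => (hq₁.2 e).2.1) (fun e => (hq₂.2 e).2.1)
    (fun e => (smoothStep_posStep n).contDiff.continuous.measurable.comp ((hU₁ e).sub (hU₂ e)))
    (fun _ _ => posStep_nonneg n _) (fun _ _ => posStep_le_one n _)
    (fun e => (measurable_deriv _).comp ((hU₁ e).sub (hU₂ e)))
    (fun _ _ => deriv_posStep_nonneg n _) (C := C) (fun _ _ => hC _)
    (fun _ => posStep_nonneg n _) (fun _ => posStep_le_one n _)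
  simpa only [Pi.add_apply, Function.comp_apply, Prod.fst_swap, Prod.snd_swap, deriv_negStep,
    negStep, neg_sub] using this

lemma posDist_doubling_le (S₁ : RegularSolution G p γ T v₁ U₁ D₁ F₁ Z₁ W₁)
    (S₂ : RegularSolution G p γ T v₂ U₂ D₂ F₂ Z₂ W₂) (hp : ∀ e, 1 < p e)
    {g : G.E → ℝ → ℝ} (hγ : ∀ e, Continuous (γ e)) (hg : ∀ e, Continuous (g e))
    (hgγ : ∀ e r, g e (γ e r) = r) (hgm : ∀ e, StrictMono (g e))
    {a b c d : ℝ} (ha : 0 < a) (hab : a < b) (hbT : b < T) (hc : 0 < c) (hcd : c < d)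
    (hdT : d < T) :
    ((∫ s in Ioo c d, posDist G (v₁ b) (v₂ s)) - ∫ s in Ioo c d, posDist G (v₁ a) (v₂ s)) +
    ((∫ t in Ioo a b, posDist G (v₁ t) (v₂ d)) - ∫ t in Ioo a b, posDist G (v₁ t) (v₂ c)) ≤
    ∫ q, dataGap G (F₁ q.1) (F₂ q.2) (W₁ q.1) (W₂ q.2)
      ∂((volume.restrict (Ioo a b)).prod (volume.restrict (Ioo c d))) := by
  have hpos := fun {r : G.E → ℝ → ℝ} (hr : ∀ e, Integrable (r e) (G.edgeMeasure e)) =>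
    S₂.tendsto_integral_entropy hγ hg smoothStep_posStep (H := fun w r => max (r - w) 0)
      (fun e => entropy.tendsto_posStep (hgγ e) (hg e) (hgm e)) hc.le hdT.le hr
  have hneg := fun {r : G.E → ℝ → ℝ} (hr : ∀ e, Integrable (r e) (G.edgeMeasure e)) =>
    S₁.tendsto_integral_entropy hγ hg smoothStep_negStep (H := fun w r => max (w - r) 0)
      (fun e => entropy.tendsto_negStep (hgγ e) (hg e) (hgm e)) ha.le hbT.le hr
  have hb := hpos (S₁.integrable_v b ⟨(ha.trans hab).le, hbT.le⟩)
  have ha' := hpos (S₁.integrable_v a ⟨ha.le, (hab.trans hbT).le⟩)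
  have hd := hneg (S₂.integrable_v d ⟨(hc.trans hcd).le, hdT.le⟩)
  have hc' := hneg (S₂.integrable_v c ⟨hc.le, (hcd.trans hdT).le⟩)
  refine le_of_tendsto ((hb.2.sub ha'.2).add (hd.2.sub hc'.2)) (Eventually.of_forall fun n => ?_)
  have := S₁.entropy_doubling_le S₂ hp hγ hg hgγ hgm n ha hab hbT hc hcd hdT
  rwa [integral_sub (hb.1 n) (ha'.1 n), integral_sub (hd.1 n) (hc'.1 n)] at this

end RegularSolution

/-- The variation of the source and the vertex fluxes between two times. -/
noncomputable def dataVariation (G : MetricGraph) (F : ℝ → G.E → ℝ → ℝ) (W : ℝ → G.V → ℝ)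
    (τ t : ℝ) : ℝ :=
  ∑ e, (∫ x, |F τ e x - F t e x| ∂G.edgeMeasure e) + ∑ z, |W τ z - W t z|

lemma dataVariation_self {G : MetricGraph} (F : ℝ → G.E → ℝ → ℝ) (W : ℝ → G.V → ℝ) (t : ℝ) :
    dataVariation G F W t t = 0 := by
  simp [dataVariation]

lemma dataGap_nonneg {G : MetricGraph} (F₁ F₂ : G.E → ℝ → ℝ) (W₁ W₂ : G.V → ℝ) :
    0 ≤ dataGap G F₁ F₂ W₁ W₂ :=
  add_nonneg (Finset.sum_nonneg fun _ _ => integral_nonneg fun _ => le_max_right _ _)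
    (Finset.sum_nonneg fun _ _ => le_max_right _ _)

lemma max_sub_le_max_sub_add (r₁ r₂ r₁' r₂' : ℝ) :
    max (r₁ - r₂) 0 ≤ max (r₁' - r₂') 0 + |r₁ - r₁'| + |r₂ - r₂'| := by
  have h1 := le_abs_self (r₁ - r₁')
  have h2 := neg_abs_le (r₂ - r₂')
  have h3 := le_max_left (r₁' - r₂') 0
  have h4 := le_max_right (r₁' - r₂') 0
  have := abs_nonneg (r₁ - r₁')
  have := abs_nonneg (r₂ - r₂')
  exact max_le (by linarith) (by linarith)

lemma integral_max_sub_le {μ : Measure ℝ} {f₁ f₂ f₁' f₂' : ℝ → ℝ} (h₁ : Integrable f₁ μ)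
    (h₂ : Integrable f₂ μ) (h₁' : Integrable f₁' μ) (h₂' : Integrable f₂' μ) :
    ∫ x, max (f₁ x - f₂ x) 0 ∂μ ≤
      ∫ x, max (f₁' x - f₂' x) 0 ∂μ + ∫ x, |f₁ x - f₁' x| ∂μ + ∫ x, |f₂ x - f₂' x| ∂μ := by
  have i1 := (h₁'.sub h₂').pos_part
  have i2 := (h₁.sub h₁').abs
  have i3 := (h₂.sub h₂').abs
  refine (integral_mono (h₁.sub h₂).pos_part ((i1.add i2).add i3) fun x =>
    max_sub_le_max_sub_add _ _ (f₁' x) (f₂' x)).trans_eq ?_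
  exact (integral_add (i1.add i2) i3).trans (congrArg (· + _) (integral_add i1 i2))

lemma posDist_le {G : MetricGraph} {v₁ v₂ v₁' v₂' : G.E → ℝ → ℝ}
    (h₁ : ∀ e, Integrable (v₁ e) (G.edgeMeasure e)) (h₂ : ∀ e, Integrable (v₂ e) (G.edgeMeasure e))
    (h₁' : ∀ e, Integrable (v₁' e) (G.edgeMeasure e))
    (h₂' : ∀ e, Integrable (v₂' e) (G.edgeMeasure e)) :
    posDist G v₁ v₂ ≤ posDist G v₁' v₂' + ∑ e, ∫ x, |v₁ e x - v₁' e x| ∂G.edgeMeasure e +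
      ∑ e, ∫ x, |v₂ e x - v₂' e x| ∂G.edgeMeasure e := by
  unfold posDist
  rw [← Finset.sum_add_distrib, ← Finset.sum_add_distrib]
  exact Finset.sum_le_sum fun e _ => integral_max_sub_le (h₁ e) (h₂ e) (h₁' e) (h₂' e)

lemma dataGap_le {G : MetricGraph} {F₁ F₂ : ℝ → G.E → ℝ → ℝ} {W₁ W₂ : ℝ → G.V → ℝ} {τ σ t : ℝ}
    (h₁ : ∀ e, Integrable (F₁ τ e) (G.edgeMeasure e))
    (h₂ : ∀ e, Integrable (F₂ σ e) (G.edgeMeasure e))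
    (h₁' : ∀ e, Integrable (F₁ t e) (G.edgeMeasure e))
    (h₂' : ∀ e, Integrable (F₂ t e) (G.edgeMeasure e)) :
    dataGap G (F₁ τ) (F₂ σ) (W₁ τ) (W₂ σ) ≤ dataGap G (F₁ t) (F₂ t) (W₁ t) (W₂ t) +
      dataVariation G F₁ W₁ τ t + dataVariation G F₂ W₂ σ t := by
  have hE := posDist_le h₁ h₂ h₁' h₂'
  have hV : ∑ z, max (W₁ τ z - W₂ σ z) 0 ≤ ∑ z, max (W₁ t z - W₂ t z) 0 +
      ∑ z, |W₁ τ z - W₁ t z| + ∑ z, |W₂ σ z - W₂ t z| := by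
    rw [← Finset.sum_add_distrib, ← Finset.sum_add_distrib]
    exact Finset.sum_le_sum fun z _ => max_sub_le_max_sub_add _ _ _ _
  unfold posDist at hE
  unfold dataGap dataVariation
  linarith

namespace RegularSolution

variable {G : MetricGraph} {p : G.E → ℝ} {γ : G.E → ℝ → ℝ} {T : ℝ}
  {v U D F v₁ U₁ D₁ F₁ v₂ U₂ D₂ F₂ : ℝ → G.E → ℝ → ℝ} {Z W Z₁ W₁ Z₂ W₂ : ℝ → G.V → ℝ}

lemma diagonalRegular_dataVariation (S : RegularSolution G p γ T v U D F Z W) {a b : ℝ}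
    (ha : 0 < a) (hbT : b ≤ T) : DiagonalRegular a b (dataVariation G F W) := by
  refine (DiagonalRegular.sum _ ha fun e _ => ?_).add ha (DiagonalRegular.sum _ ha fun z _ => ?_)
  · exact DiagonalRegular.abs_sub (K := fun q => F q.1 e q.2) ha hbT (S.measurable_F e)
      (S.integrable_F e)
  · have := DiagonalRegular.abs_sub (K := fun q => W q.1 z) (ν := Measure.dirac 0) ha hbT
      ((S.measurable_W z).comp measurable_fst)
      ((S.integrable_W z).comp_fst _)
    simpa using this

lemma integrable_dataVariation (S : RegularSolution G p γ T v U D F Z W) {t : ℝ}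
    (ht : ∀ e, Integrable (F t e) (G.edgeMeasure e)) :
    IntegrableOn (fun τ => dataVariation G F W τ t) (Ioo 0 T) :=
  (integrable_finsetSum _ fun e _ =>
    ((S.integrable_F e).sub ((ht e).comp_snd _)).abs.integral_prod_left).add
    (integrable_finsetSum _ fun z _ => ((S.integrable_W z).sub (integrable_const _)).abs)

lemma integrable_dataGap_diag (S₁ : RegularSolution G p γ T v₁ U₁ D₁ F₁ Z₁ W₁)
    (S₂ : RegularSolution G p γ T v₂ U₂ D₂ F₂ Z₂ W₂) :
    IntegrableOn (fun t => dataGap G (F₁ t) (F₂ t) (W₁ t) (W₂ t)) (Ioo 0 T) :=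
  (integrable_finsetSum _ fun e _ =>
    ((S₁.integrable_F e).sub (S₂.integrable_F e)).pos_part.integral_prod_left).add
    (integrable_finsetSum _ fun z _ => ((S₁.integrable_W z).sub (S₂.integrable_W z)).pos_part)

lemma tendsto_sum_projIcc (S : RegularSolution G p γ T v U D F Z W) (hT : 0 ≤ T) (t₀ : ℝ) :
    Tendsto (fun t => ∑ e, ∫ x, |v (projIcc 0 T hT t) e x - v (projIcc 0 T hT t₀) e x|
      ∂G.edgeMeasure e) (𝓝 t₀) (𝓝 0) := by
  have h : Tendsto (fun t => (projIcc 0 T hT t : ℝ)) (𝓝 t₀) (𝓝[Icc 0 T] (projIcc 0 T hT t₀ : ℝ)) :=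
    tendsto_nhdsWithin_iff.2 ⟨(continuous_subtype_val.comp continuous_projIcc).tendsto t₀,
      Eventually.of_forall fun t => (projIcc 0 T hT t).2⟩
  simpa using tendsto_finsetSum Finset.univ fun e _ =>
    (S.tendsto_v e _ (projIcc 0 T hT t₀).2).comp h

lemma continuous_posDist (S₁ : RegularSolution G p γ T v₁ U₁ D₁ F₁ Z₁ W₁)
    (S₂ : RegularSolution G p γ T v₂ U₂ D₂ F₂ Z₂ W₂) (hT : 0 ≤ T) :
    Continuous (Function.uncurry fun t s =>
      posDist G (v₁ (projIcc 0 T hT t)) (v₂ (projIcc 0 T hT s))) := by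
  refine continuous_iff_continuousAt.2 fun ⟨t₀, s₀⟩ => ?_
  have hlim := ((S₁.tendsto_sum_projIcc hT t₀).comp (continuous_fst.tendsto (t₀, s₀))).add
    ((S₂.tendsto_sum_projIcc hT s₀).comp (continuous_snd.tendsto (t₀, s₀)))
  rw [add_zero] at hlim
  refine tendsto_iff_dist_tendsto_zero.2 (squeeze_zero (fun _ => dist_nonneg) ?_ hlim)
  rintro ⟨t, s⟩
  have i₁ := fun t => S₁.integrable_v _ (projIcc 0 T hT t).2
  have i₂ := fun t => S₂.integrable_v _ (projIcc 0 T hT t).2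
  have h1 := posDist_le (i₁ t) (i₂ s) (i₁ t₀) (i₂ s₀)
  have h2 := posDist_le (i₁ t₀) (i₂ s₀) (i₁ t) (i₂ s)
  simp_rw [abs_sub_comm (v₁ (projIcc 0 T hT t₀) _ _), abs_sub_comm (v₂ (projIcc 0 T hT s₀) _ _)]
    at h2
  rw [Real.dist_eq, abs_le]
  simp only [Function.uncurry, Function.comp_apply]
  exact ⟨by linarith, by linarith⟩

lemma posDist_diag_sub_le (S₁ : RegularSolution G p γ T v₁ U₁ D₁ F₁ Z₁ W₁)
    (S₂ : RegularSolution G p γ T v₂ U₂ D₂ F₂ Z₂ W₂) (hp : ∀ e, 1 < p e)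
    {g : G.E → ℝ → ℝ} (hγ : ∀ e, Continuous (γ e)) (hg : ∀ e, Continuous (g e))
    (hgγ : ∀ e r, g e (γ e r) = r) (hgm : ∀ e, StrictMono (g e))
    {a b : ℝ} (ha : 0 < a) (hab : a < b) (hbT : b < T) :
    posDist G (v₁ b) (v₂ b) - posDist G (v₁ a) (v₂ a) ≤
      ∫ t in Ioo a b, dataGap G (F₁ t) (F₂ t) (W₁ t) (W₂ t) := by
  have hT : 0 ≤ T := by linarith
  have hsub : Ioo a b ⊆ Ioo 0 T := Ioo_subset_Ioo ha.le hbT.le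
  have hproj : ∀ t ∈ Icc 0 T, (projIcc 0 T hT t : ℝ) = t := fun t ht => by
    rw [projIcc_of_mem hT ht]
  have hΦ := S₁.continuous_posDist S₂ hT
  have key := DiagonalRegular.diag_sub_le (a := a) (b := b) ha hab hΦ
    (Λ := fun τ t => dataGap G (F₁ t) (F₂ t) (W₁ t) (W₂ t) + dataVariation G F₁ W₁ τ t +
      dataVariation G F₂ W₂ τ t)
    (((DiagonalRegular.const_left ((S₁.integrable_dataGap_diag S₂).mono_set hsub)).add ha
      (S₁.diagonalRegular_dataVariation ha hbT.le)).add ha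
      (S₂.diagonalRegular_dataVariation ha hbT.le)) ?_
  · simp only [dataVariation_self, add_zero] at key
    rwa [hproj a ⟨ha.le, by linarith⟩, hproj b ⟨by linarith, hbT.le⟩] at key
  intro h hh
  filter_upwards [ae_restrict_mem measurableSet_Ioo,
    ae_restrict_of_ae_restrict_of_subset hsub (S₁.ae_slice hγ),
    ae_restrict_of_ae_restrict_of_subset hsub (S₂.ae_slice hγ)] with t ht hsl₁ hsl₂
  have h0 : 0 < t - h := by linarith [hh.2, ht.1]
  have hlt : t - h < t := by linarith [hh.1]
  have htT : t < T := ht.2.trans hbT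
  have hsubt : Ioo (t - h) t ⊆ Ioo 0 T := Ioo_subset_Ioo h0.le htT.le
  have hΦ₁ : ∀ s, Continuous fun r => posDist G (v₁ (projIcc 0 T hT s)) (v₂ (projIcc 0 T hT r)) :=
    fun s => hΦ.comp (Continuous.prodMk_right s)
  have hΦ₂ : ∀ s, Continuous fun r => posDist G (v₁ (projIcc 0 T hT r)) (v₂ (projIcc 0 T hT s)) :=
    fun s => hΦ.comp (Continuous.prodMk_left s)
  have hdoub := S₁.posDist_doubling_le S₂ hp hγ hg hgγ hgm h0 hlt htT h0 hlt htT
  have e₁ : ∀ s, ∫ r in Ioo (t - h) t, posDist G (v₁ s) (v₂ (projIcc 0 T hT r)) =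
      ∫ r in Ioo (t - h) t, posDist G (v₁ s) (v₂ r) := fun s =>
    setIntegral_congr_fun measurableSet_Ioo fun r hr => by
      simp only [hproj r (Ioo_subset_Icc_self (hsubt hr))]
  have e₂ : ∀ s, ∫ r in Ioo (t - h) t, posDist G (v₁ (projIcc 0 T hT r)) (v₂ s) =
      ∫ r in Ioo (t - h) t, posDist G (v₁ r) (v₂ s) := fun s =>
    setIntegral_congr_fun measurableSet_Ioo fun r hr => by
      simp only [hproj r (Ioo_subset_Icc_self (hsubt hr))]
  rw [intervalIntegral.integral_sub ((hΦ₁ _).intervalIntegrable _ _)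
    ((hΦ₁ _).intervalIntegrable _ _), intervalIntegral.integral_sub
    ((hΦ₂ _).intervalIntegrable _ _) ((hΦ₂ _).intervalIntegrable _ _)]
  simp only [intervalIntegral.integral_of_le hlt.le, integral_Ioc_eq_integral_Ioo,
    hproj t ⟨by linarith, htT.le⟩, hproj (t - h) ⟨h0.le, by linarith⟩, e₁, e₂]
  refine hdoub.trans ?_
  have i₁ := (S₁.integrable_dataVariation fun e => (hsl₁.2 e).1).mono_set hsubt
  have i₂ := (S₂.integrable_dataVariation fun e => (hsl₂.2 e).1).mono_set hsubt
  have hle : (volume.restrict (Ioo (t - h) t)).prod (volume.restrict (Ioo (t - h) t)) ≤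
      (volume.restrict (Ioo 0 T)).prod (volume.restrict (Ioo 0 T)) :=
    Measure.prod_mono (Measure.restrict_mono hsubt le_rfl) (Measure.restrict_mono hsubt le_rfl)
  have hreal : (volume.restrict (Ioo (t - h) t)).real univ = h := by
    simp [measureReal_restrict_apply, hh.1.le]
  have ic : Integrable (fun _ => dataGap G (F₁ t) (F₂ t) (W₁ t) (W₂ t))
    (volume.restrict (Ioo (t - h) t)) := integrable_const _
  have j := (ic.comp_fst (volume.restrict (Ioo (t - h) t))).add
    (i₁.comp_fst (volume.restrict (Ioo (t - h) t)))
  have j₂ := i₂.comp_snd (volume.restrict (Ioo (t - h) t))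
  refine (integral_mono_ae ((S₁.integrable_dataGap S₂).mono_measure hle) (j.add j₂) ?_).trans_eq ?_
  · filter_upwards [Measure.quasiMeasurePreserving_fst.ae
      (ae_restrict_of_ae_restrict_of_subset hsubt (S₁.ae_slice hγ)),
      Measure.quasiMeasurePreserving_snd.ae
      (ae_restrict_of_ae_restrict_of_subset hsubt (S₂.ae_slice hγ))] with q hq₁ hq₂
    exact dataGap_le (fun e => (hq₁.2 e).1) (fun e => (hq₂.2 e).1) (fun e => (hsl₁.2 e).1)
      (fun e => (hsl₂.2 e).1)
  · refine (integral_add j j₂).trans ?_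
    have := integral_fun_fst (μ := volume.restrict (Ioo (t - h) t))
      (ν := volume.restrict (Ioo (t - h) t)) fun τ =>
        dataGap G (F₁ t) (F₂ t) (W₁ t) (W₂ t) + dataVariation G F₁ W₁ τ t
    refine (congrArg₂ (· + ·) this (integral_fun_snd (μ := volume.restrict (Ioo (t - h) t))
      (ν := volume.restrict (Ioo (t - h) t)) fun τ => dataVariation G F₂ W₂ τ t)).trans ?_
    rw [hreal, smul_eq_mul, smul_eq_mul, ← mul_add]
    exact congrArg (h * ·) (integral_add (ic.add i₁) i₂).symm

lemma posDist_le_add (S₁ : RegularSolution G p γ T v₁ U₁ D₁ F₁ Z₁ W₁)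
    (S₂ : RegularSolution G p γ T v₂ U₂ D₂ F₂ Z₂ W₂) (hp : ∀ e, 1 < p e)
    {g : G.E → ℝ → ℝ} (hγ : ∀ e, Continuous (γ e)) (hg : ∀ e, Continuous (g e))
    (hgγ : ∀ e r, g e (γ e r) = r) (hgm : ∀ e, StrictMono (g e))
    {b : ℝ} (hb : 0 < b) (hbT : b < T) :
    posDist G (v₁ b) (v₂ b) ≤ posDist G (v₁ 0) (v₂ 0) +
      ∫ t in Ioo 0 b, dataGap G (F₁ t) (F₂ t) (W₁ t) (W₂ t) := by
  have hT : 0 ≤ T := by linarith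
  have hlim := (((S₁.continuous_posDist S₂ hT).comp (continuous_id.prodMk continuous_id)).tendsto
    0).mono_left (nhdsWithin_le_nhds (s := Ioi 0))
  simp only [Function.comp_def, Function.uncurry, id, projIcc_left] at hlim
  refine ge_of_tendsto (hlim.add_const _) ?_
  filter_upwards [Ioo_mem_nhdsGT hb] with a ha
  rw [projIcc_of_mem hT ⟨ha.1.le, (ha.2.trans hbT).le⟩]
  have := S₁.posDist_diag_sub_le S₂ hp hγ hg hgγ hgm ha.1 ha.2 hbT
  have := setIntegral_mono_set ((S₁.integrable_dataGap_diag S₂).mono_set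
    (Ioo_subset_Ioo le_rfl hbT.le)) (Eventually.of_forall fun t => dataGap_nonneg _ _ _ _)
    (Ioo_subset_Ioo_left (b := b) ha.1.le).eventuallyLE
  linarith

end RegularSolution

/-- Theorem 3.20, contraction principle: comparison of two weak solutions
of the evolution problem in terms of the positive parts of the differences of the
initial data, the sources and the vertex fluxes. -/
theorem graph_evolution_contraction_principle
    (G : MetricGraph) (p : G.E → ℝ) (hp : ∀ e, 1 < p e)
    (γ : G.E → ℝ → ℝ)
    (hγ : ∀ e, Continuous (γ e) ∧ StrictMono (γ e) ∧ Function.Surjective (γ e) ∧ γ e 0 = 0)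
    (f₁ f₂ : ℝ → G.E → ℝ → ℝ)
    (hf : ∀ T : ℝ, 0 < T → ∀ e,
      (IntegrableOn (fun q : ℝ × ℝ => f₁ q.1 e q.2)
        (Ioo (0:ℝ) T ×ˢ Ioo (0:ℝ) (G.len e)) volume ∧
       IntegrableOn (fun q : ℝ × ℝ => |f₁ q.1 e q.2| ^ (p e / (p e - 1)))
        (Ioo (0:ℝ) T ×ˢ Ioo (0:ℝ) (G.len e)) volume) ∧
      (IntegrableOn (fun q : ℝ × ℝ => f₂ q.1 e q.2)
        (Ioo (0:ℝ) T ×ˢ Ioo (0:ℝ) (G.len e)) volume ∧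
       IntegrableOn (fun q : ℝ × ℝ => |f₂ q.1 e q.2| ^ (p e / (p e - 1)))
        (Ioo (0:ℝ) T ×ˢ Ioo (0:ℝ) (G.len e)) volume))
    (ω₁ ω₂ : ℝ → G.V → ℝ)
    (hωm : ∀ z : G.V, AEStronglyMeasurable (fun t => ω₁ t z) (volume.restrict (Ioi 0)) ∧
      AEStronglyMeasurable (fun t => ω₂ t z) (volume.restrict (Ioi 0)))
    (hωb : ∀ T : ℝ, 0 < T → ∃ K : ℝ, ∀ z : G.V,
      (∀ᵐ t ∂(volume.restrict (Ioo (0:ℝ) T)), |ω₁ t z| ≤ K) ∧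
      (∀ᵐ t ∂(volume.restrict (Ioo (0:ℝ) T)), |ω₂ t z| ≤ K))
    (v₁₀ v₂₀ : G.E → ℝ → ℝ)
    (hv₀ : ∀ e, IntegrableOn (v₁₀ e) (Ioo 0 (G.len e)) volume ∧
      IntegrableOn (v₂₀ e) (Ioo 0 (G.len e)) volume)
    (hj : ∀ e, IntegrableOn (fun x => jstar (γ e) (v₁₀ e x)) (Ioo 0 (G.len e)) volume ∧
      IntegrableOn (fun x => jstar (γ e) (v₂₀ e x)) (Ioo 0 (G.len e)) volume)
    (v₁ v₂ : ℝ → G.E → ℝ → ℝ)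
    (hsol₁ : ∀ T : ℝ, 0 < T → IsEvolWeakSolution G p γ f₁ ω₁ v₁₀ T v₁)
    (hsol₂ : ∀ T : ℝ, 0 < T → IsEvolWeakSolution G p γ f₂ ω₂ v₂₀ T v₂) :
    ∀ t : ℝ, 0 < t →
      edgeSum G (fun e => ∫ x in Ioo (0:ℝ) (G.len e), max (v₁ t e x - v₂ t e x) 0)
        ≤ edgeSum G (fun e => ∫ x in Ioo (0:ℝ) (G.len e), max (v₁₀ e x - v₂₀ e x) 0)
          + (∫ s in Ioo (0:ℝ) t, edgeSum G (fun e =>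
              ∫ x in Ioo (0:ℝ) (G.len e), max (f₁ s e x - f₂ s e x) 0))
          + vertexSum G (fun z => ∫ s in Ioo (0:ℝ) t, max (ω₁ s z - ω₂ s z) 0) := by
  intro t ht
  rcases isEmpty_or_nonempty G.E with hE | hE
  · have hnn : 0 ≤ vertexSum G fun z => ∫ s in Ioo (0:ℝ) t, max (ω₁ s z - ω₂ s z) 0 :=
      Finset.sum_nonneg fun _ _ => integral_nonneg fun _ => le_max_right _ _
    simpa [edgeSum] using hnn
  have hT : (0:ℝ) < t + 1 := by linarith
  have hμ : ∀ e, (volume.restrict (Ioo 0 (t + 1))).prod (G.edgeMeasure e) =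
      (volume : Measure (ℝ × ℝ)).restrict (Ioo 0 (t + 1) ×ˢ Ioo 0 (G.len e)) := fun e => by
    rw [Measure.volume_eq_prod, Measure.prod_restrict]
  have hω : ∀ {ω : ℝ → G.V → ℝ} {K : ℝ} (z : G.V),
      AEStronglyMeasurable (fun t => ω t z) (volume.restrict (Ioi 0)) →
      (∀ᵐ s ∂(volume.restrict (Ioo (0:ℝ) (t + 1))), |ω s z| ≤ K) →
      IntegrableOn (fun s => ω s z) (Ioo 0 (t + 1)) := fun z hm hK =>
    (memLp_top_of_abs_le (hm.mono_measure (Measure.restrict_mono Ioo_subset_Ioi_self le_rfl))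
      hK).integrable le_top
  obtain ⟨K, hK⟩ := hωb (t + 1) hT
  obtain ⟨U₁, D₁, F₁, Z₁, W₁, S₁, hF₁, hW₁⟩ := (hsol₁ _ hT).exists_regularSolution hp
    (fun e => by
      rw [hμ]
      exact (hf _ hT e).1.1) (fun z => hω z (hωm z).1 (hK z).1)
  obtain ⟨U₂, D₂, F₂, Z₂, W₂, S₂, hF₂, hW₂⟩ := (hsol₂ _ hT).exists_regularSolution hp
    (fun e => by
      rw [hμ]
      exact (hf _ hT e).2.1) (fun z => hω z (hωm z).2 (hK z).2)
  have key := S₁.posDist_le_add S₂ hp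
    (g := fun e => ((hγ e).2.1.orderIsoOfSurjective (γ e) (hγ e).2.2.1).symm) (fun e => (hγ e).1)
    (fun e => OrderIso.continuous _)
    (fun e r => StrictMono.orderIsoOfSurjective_symm_apply_self _ _ _ r)
    (fun e => OrderIso.strictMono _) ht (lt_add_one t)
  have hinit : posDist G (v₁ 0) (v₂ 0) =
      edgeSum G fun e => ∫ x in Ioo (0:ℝ) (G.len e), max (v₁₀ e x - v₂₀ e x) 0 := by
    refine Finset.sum_congr rfl fun e _ => integral_congr_ae ?_
    filter_upwards [(hsol₁ _ hT).2.2.1 e, (hsol₂ _ hT).2.2.1 e] with x h1 h2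
    rw [h1, h2]
  have hsub : Ioo 0 t ⊆ Ioo 0 (t + 1) := Ioo_subset_Ioo le_rfl (by linarith)
  have iF : IntegrableOn (fun s => posDist G (F₁ s) (F₂ s)) (Ioo 0 t) :=
    integrable_finsetSum _ fun e _ => IntegrableOn.mono_set (Integrable.integral_prod_left
      ((S₁.integrable_F e).sub (S₂.integrable_F e)).pos_part) hsub
  have iW : ∀ z, IntegrableOn (fun s => max (W₁ s z - W₂ s z) 0) (Ioo 0 t) := fun z =>
    IntegrableOn.mono_set ((S₁.integrable_W z).sub (S₂.integrable_W z)).pos_part hsub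
  have hgap : ∫ s in Ioo 0 t, dataGap G (F₁ s) (F₂ s) (W₁ s) (W₂ s) =
      (∫ s in Ioo (0:ℝ) t, edgeSum G fun e =>
        ∫ x in Ioo (0:ℝ) (G.len e), max (f₁ s e x - f₂ s e x) 0) +
      vertexSum G fun z => ∫ s in Ioo (0:ℝ) t, max (ω₁ s z - ω₂ s z) 0 := by
    refine (integral_add iF (integrable_finsetSum _ fun z _ => iW z)).trans
      (congrArg₂ (· + ·) (integral_congr_ae ?_) ((integral_finsetSum _ fun z _ => iW z).trans
        (Finset.sum_congr rfl fun z _ => integral_congr_ae ?_)))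
    · filter_upwards [ae_restrict_of_ae_restrict_of_subset hsub (ae_all_iff.2 hF₁),
        ae_restrict_of_ae_restrict_of_subset hsub (ae_all_iff.2 hF₂)] with s h1 h2
      refine Finset.sum_congr rfl fun e _ => integral_congr_ae ?_
      filter_upwards [h1 e, h2 e] with x h1 h2
      rw [h1, h2]
    · filter_upwards [ae_restrict_of_ae_restrict_of_subset hsub (hW₁ z),
        ae_restrict_of_ae_restrict_of_subset hsub (hW₂ z)] with s h1 h2
      rw [h1, h2]
  rw [hinit, hgap, ← add_assoc] at key
  exact key
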